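/- arXiv:1511.05215 — 2 statements merged into one kernel-verified Lean document; each statement's English description precedes it below -/
import Mathlib

section
/- Assume 0 < α < 1, either (-j < a + c < -j + 1 and (a - c < -j or c - a < -j + 1)) or ((a + c < -N + 1 or 0 < a + c) and 0 < c - a < 1), that the N+1 grid points y_0, …, y_N are pairwise distinct, and that the Pochhammer symbols (a+c)_{j+1}, (c-a)_j, (a-c)_{j+1}, (2a+1)_j, (2c+1)_{j-1}, (a)_j, (2a+1+j)_j, (a-c+1)_j, (a+c+j)_j, (c)_{j-1}, (2c+j)_{j-1}, (c-a+1)_{j-1}, (a+c+j+1)_{j-1} are all nonzero. Then the even-case monic para-Racah polynomials satisfy the orthogonality relation Σ_{s=0}^{N} P_n(y_s) P_m(y_s) w_s = (u_1 u_2 ⋯ u_n) δ_{nm} for all 0 ≤ n, m ≤ N. -/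
open Filter Topology Polynomial

noncomputable section

/-- The recurrence coefficient `bₙ` of the para-Racah polynomials, even case `N = 2j`. -/
def bEven (j : ℕ) (a c : ℝ) (n : ℕ) : ℝ :=
  ((n : ℝ) - 2 * j) * ((n : ℝ) + a + c) * ((n : ℝ) + a - c - j + 1) /
      (2 * (2 * (n : ℝ) + 1 - 2 * j)) +
    (n : ℝ) * ((n : ℝ) - 2 * j - a - c) * ((n : ℝ) - j - 1 + c - a) /
      (2 * (2 * (n : ℝ) - 1 - 2 * j)) - a ^ 2

/-- The recurrence coefficient `uₙ` of the para-Racah polynomials, even case `N = 2j`. -/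
def uEven (j : ℕ) (a c α : ℝ) (n : ℕ) : ℝ :=
  if n = j then
    -(1 - α) * (j : ℝ) * ((j : ℝ) + 1) * (a - c) * (a - c + 1) * (a + c + j - 1) * (a + c + j) / 2
  else if n = j + 1 then
    -α * (j : ℝ) * ((j : ℝ) + 1) * (a - c) * (a - c + 1) * (a + c + j - 1) * (a + c + j) / 2
  else
    (n : ℝ) * (2 * (j : ℝ) - n + 1) * (a + c + n - 1) * (a - c + j - n + 1)
        * (-a + c + j - n) * (a + c + 2 * j - n) /
      (4 * (2 * (j : ℝ) - 2 * n + 1) ^ 2)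

/-- Monic orthogonal polynomial sequence from a three-term recurrence:
`monicOPS b u n = (P_{n-1}, P_n)` with `P₋₁ = 0`, `P₀ = 1`,
`P_{n+1}(y) = (y - bₙ) Pₙ(y) - uₙ P_{n-1}(y)`. -/
def monicOPS (b u : ℕ → ℝ) : ℕ → Polynomial ℝ × Polynomial ℝ
  | 0 => (0, 1)
  | n + 1 =>
    ((monicOPS b u n).2,
      (X - C (b n)) * (monicOPS b u n).2 - C (u n) * (monicOPS b u n).1)

/-- The monic para-Racah polynomial `Pₙ`, even case `N = 2j`. -/
def paraRacahEven (j : ℕ) (a c α : ℝ) (n : ℕ) : Polynomial ℝ :=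
  (monicOPS (bEven j a c) (uEven j a c α) n).2

/-- The Pochhammer symbol `(z)ₖ = z (z+1) ⋯ (z+k-1)`. -/
def poch (z : ℝ) (k : ℕ) : ℝ := ∏ i ∈ Finset.range k, (z + i)

/-- The quadratic bi-lattice: `y_{2s} = -(s+a)²`, `y_{2s+1} = -(s+c)²`. -/
def biLattice (a c : ℝ) (s : ℕ) : ℝ :=
  if s % 2 = 0 then -(((s / 2 : ℕ) : ℝ) + a) ^ 2 else -(((s / 2 : ℕ) : ℝ) + c) ^ 2

/-- The constant `κ_N`, even case `N = 2j`. -/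
def kappaEven (j : ℕ) (a c : ℝ) : ℝ :=
  poch (a - c - j + 1) (2 * j) * poch (a + c) (2 * j) /
    ((-1 : ℝ) ^ j * (Nat.choose (2 * j) j))

/-- The weights of the para-Racah polynomials, even case `N = 2j`. -/
def wEven (j : ℕ) (a c α : ℝ) (s : ℕ) : ℝ :=
  if s % 2 = 0 then
    2 * (1 - α) * kappaEven j a c * poch (-(j : ℝ)) (s / 2) * poch (2 * a) (s / 2)
        * poch (a + 1) (s / 2) * poch (a - c - j + 1) (s / 2) * poch (a + c) (s / 2) /
      ((Nat.factorial j) * poch (a + c) j * poch (c - a) j * poch (2 * a + 1) j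
        * poch a (s / 2) * (Nat.factorial (s / 2)) * poch (2 * a + 1 + j) (s / 2)
        * poch (a - c + 1) (s / 2) * poch (a + c + j) (s / 2))
  else
    -2 * α * kappaEven j a c * poch (-(j : ℝ) + 1) (s / 2) * poch (2 * c) (s / 2)
        * poch (c + 1) (s / 2) * poch (c - a - j) (s / 2) * poch (a + c) (s / 2) /
      ((Nat.factorial (j - 1)) * poch (a + c) (j + 1) * poch (a - c) (j + 1)
        * poch (2 * c + 1) (j - 1) * poch c (s / 2) * (Nat.factorial (s / 2))
        * poch (2 * c + j) (s / 2) * poch (c - a + 1) (s / 2) * poch (a + c + j + 1) (s / 2))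


namespace PR

/-- Wilson `A_n`. -/
def WA (N A B C D n : ℝ) : ℝ :=
  (n - N) * (n + A + B) * (n + A + C) * (n + A + D) / ((2 * n - N) * (2 * n + 1 - N))

/-- Wilson `C_n`. -/
def WC (N B C D n : ℝ) : ℝ :=
  n * (n + B + C - 1) * (n + B + D - 1) * (n + C + D - 1) / ((2 * n - 1 - N) * (2 * n - N))

/-- expansion coefficients -/
def ec (N A B C D : ℝ) (n k : ℕ) : ℝ :=
  (-1) ^ (n + k) * (Nat.choose n k : ℝ) *
    (∏ i ∈ Finset.Ico k n, ((A + B + i) * (A + C + i) * (A + D + i))) /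
    (∏ i ∈ Finset.Ico k n, ((n : ℝ) - N + i))

lemma ec_self (N A B C D : ℝ) (n : ℕ) : ec N A B C D n n = 1 := by
  simp [ec, ← two_mul]

lemma ec_gt (N A B C D : ℝ) (n k : ℕ) (h : n < k) : ec N A B C D n k = 0 := by
  simp [ec, Nat.choose_eq_zero_of_lt h]

lemma ec_k (N A B C D : ℝ) (n k : ℕ) (h : k < n) (hN : 2 * (n : ℝ) - 1 < N) :
    ec N A B C D n k = -(k + 1) * (A + B + k) * (A + C + k) * (A + D + k) /
      ((n - k) * (n - N + k)) * ec N A B C D n (k + 1) := by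
  have h1 : ((n : ℝ) - N + k) ≠ 0 := by
    have : (k : ℝ) + 1 ≤ n := by exact_mod_cast h
    intro h0; linarith
  have h2 : ((n : ℝ) - k) ≠ 0 := by
    have : (k : ℝ) + 1 ≤ n := by exact_mod_cast h
    intro h0; linarith
  have hc : (Nat.choose n (k + 1) : ℝ) * (k + 1) = (Nat.choose n k : ℝ) * (n - k) := by
    have := Nat.choose_succ_right_eq n k
    rw [← Nat.cast_sub h.le]
    exact_mod_cast this
  have h3 : ∏ i ∈ Finset.Ico (k + 1) n, ((n : ℝ) - N + i) ≠ 0 := by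
    rw [Finset.prod_ne_zero_iff]
    intro i hi h0
    rw [Finset.mem_Ico] at hi
    have : (i : ℝ) + 1 ≤ n := by exact_mod_cast hi.2
    linarith
  unfold ec
  rw [Finset.prod_eq_prod_Ico_succ_bot h, Finset.prod_eq_prod_Ico_succ_bot h]
  set X := ∏ i ∈ Finset.Ico (k + 1) n, ((A + B + i) * (A + C + i) * (A + D + i))
  set Y := ∏ i ∈ Finset.Ico (k + 1) n, ((n : ℝ) - N + i)
  rw [div_mul_div_comm, div_eq_div_iff (by positivity) (by positivity)]
  rw [show n + (k + 1) = n + k + 1 by ring, pow_succ]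
  linear_combination (-1 : ℝ) ^ (n + k) * (A + B + k) * (A + C + k) * (A + D + k) * X * Y *
    (n - N + k) * (-hc)

lemma ec_n (N A B C D : ℝ) (n k : ℕ) (h : k ≤ n) (hN : 2 * (n : ℝ) + 1 < N) :
    ec N A B C D (n + 1) k = -(n + 1) * (A + B + n) * (A + C + n) * (A + D + n) * (n - N + k) /
      ((n + 1 - k) * (2 * n - N) * (2 * n + 1 - N)) * ec N A B C D n k := by
  have hk : (k : ℝ) ≤ n := by exact_mod_cast h
  have h1 : ((n : ℝ) - N + k) ≠ 0 := by
    intro h0; linarith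
  have h2 : ((n : ℝ) + 1 - k) ≠ 0 := by
    intro h0; linarith
  have h4 : (2 * (n : ℝ) - N) ≠ 0 := by
    intro h0; linarith
  have h5 : (2 * (n : ℝ) + 1 - N) ≠ 0 := by
    intro h0; linarith
  have hc : (Nat.choose (n + 1) k : ℝ) * (n + 1 - k) = (Nat.choose n k : ℝ) * (n + 1) := by
    have := Nat.choose_mul_succ_eq n k
    have h' : ((n : ℝ) + 1 - k) = ((n + 1 - k : ℕ) : ℝ) := by
      rw [Nat.cast_sub (by omega)]; push_cast; ring
    rw [h']
    exact_mod_cast this.symm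
  have h3 : ∏ i ∈ Finset.Ico k n, ((n : ℝ) - N + i) ≠ 0 := by
    rw [Finset.prod_ne_zero_iff]
    intro i hi h0
    rw [Finset.mem_Ico] at hi
    have : (i : ℝ) + 1 ≤ n := by exact_mod_cast hi.2
    linarith
  have hG : (∏ i ∈ Finset.Ico k (n + 1), (((n + 1 : ℕ) : ℝ) - N + i)) * (n - N + k) =
      (∏ i ∈ Finset.Ico k n, ((n : ℝ) - N + i)) * (2 * n - N) * (2 * n + 1 - N) := by
    have e1 : (∏ i ∈ Finset.Ico k (n + 1), (((n + 1 : ℕ) : ℝ) - N + i)) =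
        ∏ i ∈ Finset.Ico (k + 1) (n + 1 + 1), ((n : ℝ) - N + i) := by
      rw [← Finset.prod_Ico_add' (fun i : ℕ => (n : ℝ) - N + i) k (n + 1) 1]
      apply Finset.prod_congr rfl
      intro i _; push_cast; ring
    rw [e1, mul_comm, ← Finset.prod_eq_prod_Ico_succ_bot (f := fun i : ℕ => (n : ℝ) - N + i)
      (by omega : k < n + 1 + 1), Finset.prod_Ico_succ_top (by omega), Finset.prod_Ico_succ_top h]
    push_cast; ring
  have h6 : (∏ i ∈ Finset.Ico k (n + 1), (((n + 1 : ℕ) : ℝ) - N + i)) ≠ 0 := by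
    intro h0
    rw [h0, zero_mul] at hG
    exact (mul_ne_zero (mul_ne_zero h3 h4) h5) hG.symm
  unfold ec
  rw [Finset.prod_Ico_succ_top h (fun i : ℕ => ((A + B + i) * (A + C + i) * (A + D + i)))]
  set X := ∏ i ∈ Finset.Ico k n, ((A + B + i) * (A + C + i) * (A + D + i))
  set Y := ∏ i ∈ Finset.Ico k n, ((n : ℝ) - N + i)
  set Z := (∏ i ∈ Finset.Ico k (n + 1), (((n + 1 : ℕ) : ℝ) - N + i))
  rw [div_mul_div_comm, div_eq_div_iff (by positivity) (by positivity)]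
  rw [show n + 1 + k = n + k + 1 by ring, pow_succ]
  linear_combination (-(-1 : ℝ) ^ (n + k) * (A + B + n) * (A + C + n) * (A + D + n) * X) *
    ((2 * n - N) * (2 * n + 1 - N) * Y * hc - (Nat.choose n k : ℝ) * (n + 1) * hG)

/-- core rational identity -/
lemma core1 (N A B C n k : ℝ) (h1 : n - k ≠ 0) (h2 : n + 1 - k ≠ 0) (h3 : 2 * n - N ≠ 0)
    (h4 : 2 * n + 1 - N ≠ 0) (h5 : 2 * n - 1 - N ≠ 0) (h6 : n - 1 - N ≠ 0)
    (h7 : n - 1 - N + k ≠ 0) (D : ℝ) (hD : D = 1 - N - A - B - C) :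
    n * (n - 1 - N + k) / ((n - k) * (n - 1 - N)) *
      (-(n + 1) * (A + B + n) * (A + C + n) * (A + D + n) * (n - N + k) /
      ((n + 1 - k) * (2 * n - N) * (2 * n + 1 - N))
      - (-k * (A + B + k - 1) * (A + C + k - 1) * (A + D + k - 1) /
      ((n + 1 - k) * (n - N + k - 1))) + (A + k) ^ 2 + (WA N A B C D n + WC N B C D n - A ^ 2))
     = WC N B C D n := by
  obtain ⟨p, rfl⟩ : ∃ p, k = n - p := ⟨n - k, by ring⟩
  obtain ⟨q, rfl⟩ : ∃ q, N = 2 * n - q := ⟨2 * n - N, by ring⟩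
  have e1 : n - (n - p) = p := by ring
  have e2 : n + 1 - (n - p) = p + 1 := by ring
  have e3 : 2 * n - (2 * n - q) = q := by ring
  have e4 : 2 * n + 1 - (2 * n - q) = q + 1 := by ring
  have e5 : 2 * n - 1 - (2 * n - q) = q - 1 := by ring
  have e6 : n - 1 - (2 * n - q) = q - n - 1 := by ring
  have e7 : q - n - 1 + (n - p) = q - p - 1 := by ring
  have e8 : n - (2 * n - q) + (n - p) = q - p := by ring
  subst hD
  unfold WA WC
  simp only [e1, e2, e3, e4, e5, e6, e7, e8] at *
  field_simp
  ring

end PR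

namespace PR

/-- shifted sequence -/
def prv (e : ℕ → ℝ) : ℕ → ℝ
  | 0 => 0
  | k + 1 => e k

/-- Newton-type basis -/
def phi (A x : ℝ) (k : ℕ) : ℝ := ∏ i ∈ Finset.range k, (x + (A + i) ^ 2)

lemma phi_succ (A x : ℝ) (k : ℕ) : phi A x (k + 1) = phi A x k * (x + (A + k) ^ 2) := by
  simp [phi, Finset.prod_range_succ]

lemma sum_rec (A x b u : ℝ) (e f : ℕ → ℝ) (M : ℕ) (hM : e M = 0) :
    (x - b) * ∑ k ∈ Finset.range (M + 1), e k * phi A x k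
      - u * ∑ k ∈ Finset.range (M + 1), f k * phi A x k =
    ∑ k ∈ Finset.range (M + 1), (prv e k - ((A + k) ^ 2 + b) * e k - u * f k) * phi A x k := by
  have h1 : ∑ k ∈ Finset.range (M + 1), prv e k * phi A x k =
      ∑ k ∈ Finset.range (M + 1), e k * phi A x (k + 1) := by
    rw [Finset.sum_range_succ', Finset.sum_range_succ (fun k => e k * phi A x (k + 1))]
    simp [prv, hM]
  have h2 : ∀ k, e k * phi A x (k + 1) = e k * phi A x k * (x + (A + k) ^ 2) := by
    intro k; rw [phi_succ]; ring
  have h3 : ∑ k ∈ Finset.range (M + 1), (prv e k - ((A + k) ^ 2 + b) * e k - u * f k) * phi A x k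
      = ∑ k ∈ Finset.range (M + 1), prv e k * phi A x k +
        ∑ k ∈ Finset.range (M + 1), (- ((A + k) ^ 2 + b) * e k - u * f k) * phi A x k := by
    rw [← Finset.sum_add_distrib]
    apply Finset.sum_congr rfl; intro k _; ring
  rw [h3, h1, ← Finset.sum_add_distrib, Finset.mul_sum, Finset.mul_sum, ← Finset.sum_sub_distrib]
  apply Finset.sum_congr rfl; intro k _; rw [h2]; ring

lemma prv_ec (N A B C D : ℝ) (n k : ℕ) (h : k ≤ n) (hN : 2 * (n : ℝ) - 1 < N) :
    prv (ec N A B C D n) k = -k * (A + B + k - 1) * (A + C + k - 1) * (A + D + k - 1) /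
      ((n + 1 - k) * (n - N + k - 1)) * ec N A B C D n k := by
  cases k with
  | zero => simp [prv]
  | succ k =>
    rw [prv, ec_k N A B C D n k h hN]
    push_cast
    congr 2 <;> ring

lemma core2 (N A B C D n : ℝ) (hD : D = 1 - N - A - B - C) (h3 : 2 * n - N ≠ 0)
    (h4 : 2 * n + 1 - N ≠ 0) (h5 : 2 * n - 1 - N ≠ 0) :
    -(n + 1) * (A + B + n) * (A + C + n) * (A + D + n) / (2 * n + 1 - N) =
    -n * (A + B + n - 1) * (A + C + n - 1) * (A + D + n - 1) / (2 * n - 1 - N) -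
     ((A + n) ^ 2 + (WA N A B C D n + WC N B C D n - A ^ 2)) := by
  obtain ⟨q, rfl⟩ : ∃ q, N = 2 * n - q := ⟨2 * n - N, by ring⟩
  have e3 : 2 * n - (2 * n - q) = q := by ring
  have e4 : 2 * n + 1 - (2 * n - q) = q + 1 := by ring
  have e5 : 2 * n - 1 - (2 * n - q) = q - 1 := by ring
  subst hD
  unfold WA WC
  simp only [e3, e4, e5] at *
  field_simp
  ring

lemma core0 (N A B C D n k : ℝ) (g1 : n - N ≠ 0) (g2 : n + 1 - k ≠ 0) (g3 : 2 * n - N ≠ 0)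
    (g4 : 2 * n + 1 - N ≠ 0) : -(n + 1) * (A + B + n) * (A + C + n) * (A + D + n) * (n - N + k) /
      ((n + 1 - k) * (2 * n - N) * (2 * n + 1 - N)) =
        - ((n + 1) * (n + 1 - 1 - N + k) / ((n + 1 - k) * (n + 1 - 1 - N))) * WA N A B C D n := by
  obtain ⟨p, rfl⟩ : ∃ p, k = n - p := ⟨n - k, by ring⟩
  obtain ⟨q, rfl⟩ : ∃ q, N = 2 * n - q := ⟨2 * n - N, by ring⟩
  have e2 : n + 1 - (n - p) = p + 1 := by ring
  have e3 : 2 * n - (2 * n - q) = q := by ring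
  have e4 : 2 * n + 1 - (2 * n - q) = q + 1 := by ring
  have e6 : n - (2 * n - q) = q - n := by ring
  have e7 : n + 1 - 1 - (2 * n - q) = q - n := by ring
  unfold WA
  simp only [e2, e3, e4, e6, e7] at *
  field_simp
  ring

lemma ec_rec (N A B C D : ℝ) (hD : D = 1 - N - A - B - C) (n k : ℕ) (hN : 2 * (n : ℝ) + 3 < N) :
    ec N A B C D (n + 2) k = prv (ec N A B C D (n + 1)) k -
      ((A + k) ^ 2 + (WA N A B C D (n + 1) + WC N B C D (n + 1) - A ^ 2)) * ec N A B C D (n + 1) k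
      - WA N A B C D n * WC N B C D (n + 1) * ec N A B C D n k := by
  have n0 : (0 : ℝ) ≤ n := Nat.cast_nonneg n
  rcases lt_trichotomy k (n + 1) with h | h | h
  · have hk : (k : ℝ) ≤ n := by exact_mod_cast Nat.lt_succ_iff.mp h
    have k0 : (0 : ℝ) ≤ k := Nat.cast_nonneg k
    have c1 := core1 N A B C (n + 1) k (by intro h; linarith) (by intro h; linarith)
      (by intro h; linarith) (by intro h; linarith) (by intro h; linarith) (by intro h; linarith)
      (by intro h; linarith) D hD
    have r1 := ec_n N A B C D n k (by omega) (by linarith)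
    have r2 := ec_n N A B C D (n + 1) k (by omega) (by push_cast; linarith)
    have r3 := prv_ec N A B C D (n + 1) k (by omega) (by push_cast; linarith)
    have hr : -(n + 1) * (A + B + n) * (A + C + n) * (A + D + n) * (n - N + k) /
      ((n + 1 - k) * (2 * n - N) * (2 * n + 1 - N)) =
        - ((n + 1) * (n + 1 - 1 - N + k) / ((n + 1 - k) * (n + 1 - 1 - N))) * WA N A B C D n := by
      exact core0 N A B C D n k (by intro h; linarith) (by intro h; linarith)
        (by intro h; linarith) (by intro h; linarith)
    rw [hr] at r1
    push_cast at r2 r3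
    rw [show n + 2 = n + 1 + 1 from rfl, r2, r3, r1]
    generalize (-((n : ℝ) + 1 + 1) * (A + B + (n + 1)) * (A + C + (n + 1)) * (A + D + (n + 1)) *
      (n + 1 - N + k) / ((n + 1 + 1 - k) * (2 * (n + 1) - N) * (2 * (n + 1) + 1 - N))) = R2 at *
    generalize -(k : ℝ) * (A + B + k - 1) * (A + C + k - 1) * (A + D + k - 1) /
      ((n + 1 + 1 - k) * (n + 1 - N + k - 1)) = R3 at *
    generalize ((n : ℝ) + 1) * (n + 1 - 1 - N + k) / ((n + 1 - k) * (n + 1 - 1 - N)) = R1 at *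
    linear_combination (-(WA N A B C D n * ec N A B C D n k)) * c1
  · subst h
    have r2 := ec_k N A B C D (n + 2) (n + 1) (by omega) (by push_cast; linarith)
    have r3 := ec_k N A B C D (n + 1) n (by omega) (by push_cast; linarith)
    rw [ec_self] at r2 r3
    rw [prv, r2, r3, ec_self, ec_gt _ _ _ _ _ n (n + 1) (by omega)]
    have c2 := core2 N A B C D (n + 1) hD (by intro h; linarith)
      (by intro h; linarith) (by intro h; linarith)
    push_cast
    have x1 : ((n : ℝ) + 2 - (n + 1)) * (n + 2 - N + (n + 1)) = 2 * (n + 1) + 1 - N := by ring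
    have x2 : ((n : ℝ) + 1 - n) * (n + 1 - N + n) = 2 * (n + 1) - 1 - N := by ring
    rw [x1, x2]
    have e : (((n : ℝ) + 1) + B) = n + 1 + B := rfl
    rw [show A + B + (n : ℝ) = A + B + (n + 1) - 1 by ring,
      show A + C + (n : ℝ) = A + C + (n + 1) - 1 by ring,
      show A + D + (n : ℝ) = A + D + (n + 1) - 1 by ring, mul_one, mul_one, mul_one, mul_zero,
      sub_zero, ← c2]
  · obtain ⟨l, rfl⟩ : ∃ l, k = l + 1 := ⟨k - 1, by omega⟩
    rw [prv, ec_gt _ _ _ _ _ (n + 1) (l + 1) (by omega), ec_gt _ _ _ _ _ n (l + 1) (by omega)]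
    rcases eq_or_ne l (n + 1) with h' | h'
    · subst h'; rw [ec_self, ec_self]; ring
    · rw [ec_gt _ _ _ _ _ (n + 2) (l + 1) (by omega), ec_gt _ _ _ _ _ (n + 1) l (by omega)]; ring

/-- The expansion. -/
lemma expansion (j : ℕ) (A B C D x : ℝ) (hD : D = 1 - 2 * (j : ℝ) - A - B - C) (b u p : ℕ → ℝ)
    (hb : ∀ n < j, b n = WA (2 * j) A B C D n + WC (2 * j) B C D n - A ^ 2)
    (hu : ∀ n, n + 1 < j → u (n + 1) = WA (2 * j) A B C D n * WC (2 * j) B C D (n + 1))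
    (p0 : p 0 = 1) (p1 : p 1 = x - b 0)
    (pr : ∀ n, p (n + 2) = (x - b (n + 1)) * p (n + 1) - u (n + 1) * p n) :
    ∀ n ≤ j, p n = ∑ k ∈ Finset.range (j + 1 + 1), ec (2 * j) A B C D n k * phi A x k := by
  intro n
  induction n using Nat.strong_induction_on with
  | _ n ih =>
    intro hn
    match n, ih, hn with
    | 0, _, _ =>
      rw [p0, Finset.sum_eq_single 0]
      · simp [ec_self, phi]
      · intro k _ hk; rw [ec_gt _ _ _ _ _ _ _ (by omega)]; simp
      · simp
    | 1, _, hn =>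
      have hj : (1 : ℝ) ≤ j := by exact_mod_cast hn
      rw [p1, Finset.sum_range_succ', Finset.sum_range_succ', Finset.sum_eq_zero]
      · have r3 := ec_k (2 * j) A B C D 1 0 (by omega) (by push_cast; linarith)
        rw [ec_self] at r3
        rw [r3, ec_self, hb 0 (by omega)]
        have g1 : (1 - 2 * (j : ℝ)) ≠ 0 := by intro h; linarith
        have g2 : (j : ℝ) ≠ 0 := by intro h; linarith
        subst hD
        simp [phi, WA, WC]
        field_simp
        ring
      · intro k _; rw [ec_gt _ _ _ _ _ _ _ (by omega)]; simp
    | n + 2, ih, hn =>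
      have hj : (n : ℝ) + 2 ≤ j := by exact_mod_cast hn
      rw [pr, ih (n + 1) (by omega) (by omega), ih n (by omega) (by omega), sum_rec]
      · apply Finset.sum_congr rfl
        intro k _
        rw [ec_rec (2 * j) A B C D hD n k (by linarith), hb (n + 1) (by omega), hu n (by omega)]
        push_cast; ring
      · exact ec_gt _ _ _ _ _ _ _ (by omega)

lemma bEven_a (j : ℕ) (a c : ℝ) (n : ℕ) (hn : n < j) :
    bEven j a c n = WA (2 * j) a c (1 - c - j) (-a - j) n + WC (2 * j) c (1 - c - j) (-a - j) n
      - a ^ 2 := by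
  have hn' : (n : ℝ) + 1 ≤ j := by exact_mod_cast hn
  obtain ⟨q, hq⟩ : ∃ q : ℝ, (j : ℝ) = n + q := ⟨j - n, by ring⟩
  have q1 : 1 ≤ q := by linarith
  have g1 : q ≠ 0 := by intro h; linarith
  have g2 : 2 * q - 1 ≠ 0 := by intro h; linarith
  have g3 : 2 * q + 1 ≠ 0 := by intro h; linarith
  unfold bEven WA WC
  simp only [hq]
  rw [show 2 * (n : ℝ) - 2 * (n + q) = -(2 * q) by ring,
    show 2 * (n : ℝ) + 1 - 2 * (n + q) = -(2 * q - 1) by ring,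
    show 2 * (n : ℝ) - 1 - 2 * (n + q) = -(2 * q + 1) by ring]
  field_simp
  ring

lemma bEven_c (j : ℕ) (a c : ℝ) (n : ℕ) (hn : n < j) :
    bEven j a c n = WA (2 * j) c a (1 - c - j) (-a - j) n + WC (2 * j) a (1 - c - j) (-a - j) n
      - c ^ 2 := by
  have hn' : (n : ℝ) + 1 ≤ j := by exact_mod_cast hn
  obtain ⟨q, hq⟩ : ∃ q : ℝ, (j : ℝ) = n + q := ⟨j - n, by ring⟩
  have q1 : 1 ≤ q := by linarith
  have g1 : q ≠ 0 := by intro h; linarith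
  have g2 : 2 * q - 1 ≠ 0 := by intro h; linarith
  have g3 : 2 * q + 1 ≠ 0 := by intro h; linarith
  unfold bEven WA WC
  simp only [hq]
  rw [show 2 * (n : ℝ) - 2 * (n + q) = -(2 * q) by ring,
    show 2 * (n : ℝ) + 1 - 2 * (n + q) = -(2 * q - 1) by ring,
    show 2 * (n : ℝ) - 1 - 2 * (n + q) = -(2 * q + 1) by ring]
  field_simp
  ring

lemma uEven_a (j : ℕ) (a c α : ℝ) (n : ℕ) (hn : n + 1 < j) :
    uEven j a c α (n + 1) = WA (2 * j) a c (1 - c - j) (-a - j) n *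
      WC (2 * j) c (1 - c - j) (-a - j) (n + 1) := by
  have hn' : (n : ℝ) + 1 + 1 ≤ j := by exact_mod_cast hn
  obtain ⟨q, hq⟩ : ∃ q : ℝ, (j : ℝ) = n + 1 + q := ⟨j - n - 1, by ring⟩
  have q1 : 1 ≤ q := by linarith
  have g1 : q ≠ 0 := by intro h; linarith
  have g2 : 2 * q + 1 ≠ 0 := by intro h; linarith
  have g3 : q + 1 ≠ 0 := by intro h; linarith
  unfold uEven WA WC
  rw [if_neg (by omega), if_neg (by omega)]
  push_cast
  simp only [hq]
  rw [show 2 * ((n : ℝ) + 1) - 1 - 2 * (n + 1 + q) = -(2 * q + 1) by ring,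
    show 2 * ((n : ℝ) + 1) - 2 * (n + 1 + q) = -(2 * q) by ring,
    show 2 * (n : ℝ) - 2 * (n + 1 + q) = -(2 * (q + 1)) by ring,
    show 2 * (n : ℝ) + 1 - 2 * (n + 1 + q) = -(2 * q + 1) by ring,
    show 2 * ((n : ℝ) + 1 + q) - 2 * (n + 1) + 1 = 2 * q + 1 by ring]
  field_simp
  ring

lemma uEven_c (j : ℕ) (a c α : ℝ) (n : ℕ) (hn : n + 1 < j) :
    uEven j a c α (n + 1) = WA (2 * j) c a (1 - c - j) (-a - j) n *
      WC (2 * j) a (1 - c - j) (-a - j) (n + 1) := by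
  have hn' : (n : ℝ) + 1 + 1 ≤ j := by exact_mod_cast hn
  obtain ⟨q, hq⟩ : ∃ q : ℝ, (j : ℝ) = n + 1 + q := ⟨j - n - 1, by ring⟩
  have q1 : 1 ≤ q := by linarith
  have g1 : q ≠ 0 := by intro h; linarith
  have g2 : 2 * q + 1 ≠ 0 := by intro h; linarith
  have g3 : q + 1 ≠ 0 := by intro h; linarith
  unfold uEven WA WC
  rw [if_neg (by omega), if_neg (by omega)]
  push_cast
  simp only [hq]
  rw [show 2 * ((n : ℝ) + 1) - 1 - 2 * (n + 1 + q) = -(2 * q + 1) by ring,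
    show 2 * ((n : ℝ) + 1) - 2 * (n + 1 + q) = -(2 * q) by ring,
    show 2 * (n : ℝ) - 2 * (n + 1 + q) = -(2 * (q + 1)) by ring,
    show 2 * (n : ℝ) + 1 - 2 * (n + 1 + q) = -(2 * q + 1) by ring,
    show 2 * ((n : ℝ) + 1 + q) - 2 * (n + 1) + 1 = 2 * q + 1 by ring]
  field_simp
  ring

/-- evaluated polynomial -/
def pe (j : ℕ) (a c α x : ℝ) (n : ℕ) : ℝ := (paraRacahEven j a c α n).eval x

lemma pe0 (j : ℕ) (a c α x : ℝ) : pe j a c α x 0 = 1 := by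
  simp [pe, paraRacahEven, monicOPS]

lemma pe1 (j : ℕ) (a c α x : ℝ) : pe j a c α x 1 = x - bEven j a c 0 := by
  simp [pe, paraRacahEven, monicOPS]

lemma per (j : ℕ) (a c α x : ℝ) (n : ℕ) : pe j a c α x (n + 2) =
    (x - bEven j a c (n + 1)) * pe j a c α x (n + 1) - uEven j a c α (n + 1) * pe j a c α x n := by
  simp [pe, paraRacahEven, monicOPS]

lemma pe_j (j : ℕ) (hj : 1 ≤ j) (a c α x : ℝ) : pe j a c α x j = phi c x j := by
  rw [expansion j c a (1 - c - j) (-a - j) x (by ring) (bEven j a c) (uEven j a c α) (pe j a c α x)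
    (fun n hn => bEven_c j a c n hn) (fun n hn => uEven_c j a c α n hn) (pe0 j a c α x)
    (pe1 j a c α x) (per j a c α x) j le_rfl, Finset.sum_eq_single j]
  · simp [ec_self]
  · intro k _ hk
    rcases lt_or_gt_of_ne hk with h | h
    · have : ∏ i ∈ Finset.Ico k j, ((c + a + i) * (c + (1 - c - j) + i) * (c + (-a - j) + i)) = 
          (0 : ℝ) := by
        apply Finset.prod_eq_zero (i := j - 1) (by rw [Finset.mem_Ico]; omega)
        rw [Nat.cast_sub hj]; push_cast; ring
      simp [ec, this]
    · rw [ec_gt _ _ _ _ _ _ _ h]; simp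
  · simp

/-- The standard value of `u_j`. -/
def ustd (j : ℕ) (a c : ℝ) (n : ℕ) : ℝ := 
    (n : ℝ) * (2 * (j : ℝ) - n + 1) * (a + c + n - 1) * (a - c + j - n + 1)
        * (-a + c + j - n) * (a + c + 2 * j - n) /
      (4 * (2 * (j : ℝ) - 2 * n + 1) ^ 2)

lemma core3 (a c m k : ℝ) (j : ℕ) (hm : (j : ℝ) = m + 1) (g1 : m + 1 - k ≠ 0)
    (g2 : m + 2 - k ≠ 0) :
    (-k * (a + c + k - 1) * (a + (1 - c - j) + k - 1) * (a + (-a - j) + k - 1) /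
      ((m + 1 + 1 - k) * (m + 1 - 2 * j + k - 1)) - ((a + k) ^ 2 + bEven j a c j)) * 
    (-(m + 1) * (a + c + m) * (a + (1 - c - j) + m) * (a + (-a - j) + m) * (m - 2 * j + k) /
      ((m + 1 - k) * (2 * m - 2 * j) * (2 * m + 1 - 2 * j))) - 2 * ustd j a c j = 0 := by
  unfold bEven ustd
  simp only [hm]
  rw [show 2 * m - 2 * (m + 1) = -2 by ring, show 2 * m + 1 - 2 * (m + 1) = -1 by ring,
    show 2 * (m + 1) + 1 - 2 * (m + 1) = 1 by ring,
    show 2 * (m + 1) - 1 - 2 * (m + 1) = -1 by ring,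
    show 2 * (m + 1) - 2 * (m + 1) + 1 = 1 by ring,
    show m + 1 + 1 - k = m + 2 - k by ring,
    show m + 1 - 2 * (m + 1) + k - 1 = -(m + 2 - k) by ring]
  field_simp
  ring

lemma R_eq (j : ℕ) (hj : 1 ≤ j) (a c α x : ℝ) :
    (x - bEven j a c j) * pe j a c α x j - 2 * ustd j a c j * pe j a c α x (j - 1)
      = phi a x (j + 1) := by
  obtain ⟨m, rfl⟩ : ∃ m, j = m + 1 := ⟨j - 1, by omega⟩
  have ex := expansion (m + 1) a c (1 - c - (m + 1 : ℕ)) (-a - (m + 1 : ℕ)) x (by ring)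
    (bEven (m + 1) a c) (uEven (m + 1) a c α) (pe (m + 1) a c α x)
    (fun n hn => bEven_a (m + 1) a c n hn) (fun n hn => uEven_a (m + 1) a c α n hn)
    (pe0 (m + 1) a c α x) (pe1 (m + 1) a c α x) (per (m + 1) a c α x)
  rw [Nat.add_sub_cancel, ex (m + 1) le_rfl, ex m (by omega), sum_rec, Finset.sum_range_succ,
    Finset.sum_eq_zero, prv, ec_self, ec_gt _ _ _ _ _ _ _ (Nat.lt_succ_self (m + 1)),
    ec_gt _ _ _ _ _ m _ (by omega)]
  · ring
  · intro k hk
    have hm0 : (0 : ℝ) ≤ m := Nat.cast_nonneg m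
    rw [Finset.mem_range] at hk
    rcases Nat.lt_or_ge k (m + 1) with h | h
    · have hk : (k : ℝ) ≤ m := by exact_mod_cast Nat.lt_succ_iff.mp h
      have c3 := core3 a c m k (m + 1) (by push_cast; ring) (by intro h; linarith)
        (by intro h; linarith)
      have r1 := prv_ec (2 * (m + 1 : ℕ)) a c (1 - c - (m + 1 : ℕ)) (-a - (m + 1 : ℕ)) (m + 1) k
        (by omega) (by push_cast; linarith)
      have r2 := ec_n (2 * (m + 1 : ℕ)) a c (1 - c - (m + 1 : ℕ)) (-a - (m + 1 : ℕ)) m k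
        (by omega) (by push_cast; linarith)
      rw [r1, r2]
      apply mul_eq_zero_of_left
      push_cast at c3 ⊢
      linear_combination c3 * ec (2 * (m + 1)) a c (1 - c - (m + 1)) (-a - (m + 1)) m k
    · obtain rfl : k = m + 1 := by omega
      have r1 := ec_k (2 * (m + 1 : ℕ)) a c (1 - c - (m + 1 : ℕ)) (-a - (m + 1 : ℕ)) (m + 1) m
        (by omega) (by push_cast; linarith)
      rw [prv, r1, ec_self, ec_gt _ _ _ _ _ m _ (by omega)]
      apply mul_eq_zero_of_left
      unfold bEven
      push_cast
      rw [show ((m : ℝ) + 1 - m) * (m + 1 - 2 * (m + 1) + m) = -1 by ring, 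
        show 2 * ((m : ℝ) + 1) + 1 - 2 * (m + 1) = 1 by ring,
        show 2 * ((m : ℝ) + 1) - 1 - 2 * (m + 1) = -1 by ring]
      ring
  · exact ec_gt _ _ _ _ _ _ _ (by omega)

end PR

namespace PR

lemma uEven_gen (j : ℕ) (a c α : ℝ) (n : ℕ) (h1 : n ≠ j) (h2 : n ≠ j + 1) :
    uEven j a c α n = ustd j a c n := by
  simp [uEven, ustd, h1, h2]

lemma uEven_j (j : ℕ) (a c α : ℝ) : uEven j a c α j = 2 * (1 - α) * ustd j a c j := by
  unfold uEven ustd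
  rw [if_pos rfl, show 2 * (j : ℝ) - 2 * j + 1 = 1 by ring]
  ring

lemma uEven_j1 (j : ℕ) (a c α : ℝ) : uEven j a c α (j + 1) = 2 * α * ustd j a c j := by
  unfold uEven ustd
  rw [if_neg (by omega), if_pos rfl, show 2 * (j : ℝ) - 2 * j + 1 = 1 by ring]
  ring

lemma ustd_symm (j : ℕ) (a c : ℝ) (m : ℕ) (h : m ≤ 2 * j + 1) :
    ustd j a c (2 * j + 1 - m) = ustd j a c m := by
  unfold ustd
  rw [Nat.cast_sub h]
  push_cast
  rw [show 4 * (2 * (j : ℝ) - 2 * (2 * j + 1 - m) + 1) ^ 2 = 4 * (2 * (j : ℝ) - 2 * m + 1) ^ 2 by ring]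
  congr 1
  ring

lemma uEven_symm (j : ℕ) (a c α : ℝ) (m : ℕ) (h : m < j) :
    uEven j a c α (2 * j + 1 - m) = uEven j a c α m := by
  rw [uEven_gen _ _ _ _ _ (by omega) (by omega), uEven_gen _ _ _ _ _ (by omega) (by omega),
    ustd_symm _ _ _ _ (by omega)]

lemma bEven_symm (j : ℕ) (a c : ℝ) (m : ℕ) (h : m ≤ 2 * j) :
    bEven j a c (2 * j - m) = bEven j a c m := by
  unfold bEven
  rw [Nat.cast_sub h]
  push_cast
  rw [show 2 * (2 * (2 * (j : ℝ) - m) + 1 - 2 * j) = -(2 * (2 * (m : ℝ) - 1 - 2 * j)) by ring,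
    show 2 * (2 * (2 * (j : ℝ) - m) - 1 - 2 * j) = -(2 * (2 * (m : ℝ) + 1 - 2 * j)) by ring,
    div_neg, div_neg]
  ring

lemma per' (j : ℕ) (a c α x : ℝ) (n : ℕ) (hn : 1 ≤ n) : pe j a c α x (n + 1) =
    (x - bEven j a c n) * pe j a c α x n - uEven j a c α n * pe j a c α x (n - 1) := by
  obtain ⟨m, rfl⟩ : ∃ m, n = m + 1 := ⟨n - 1, by omega⟩
  exact per j a c α x m

lemma split (j : ℕ) (a c α x : ℝ) (m : ℕ) (hm : m + 1 ≤ j) : pe j a c α x (2 * j + 1) =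
    pe j a c α x (2 * j - m) * pe j a c α x (m + 1) -
      uEven j a c α (2 * j - m) * pe j a c α x (2 * j - m - 1) * pe j a c α x m := by
  induction m with
  | zero =>
    rw [per' _ _ _ _ _ _ (by omega), pe1, pe0, ← bEven_symm j a c 0 (by omega)]
    simp only [Nat.sub_zero]
    ring
  | succ m ih =>
    rw [ih (by omega)]
    have h1 := per' j a c α x (2 * j - (m + 1)) (by omega)
    rw [show 2 * j - (m + 1) + 1 = 2 * j - m by omega, bEven_symm j a c (m + 1) (by omega)] at h1
    have h2 := per' j a c α x (m + 1) (by omega)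
    have h3 := uEven_symm j a c α (m + 1) (by omega)
    rw [show 2 * j + 1 - (m + 1) = 2 * j - m by omega] at h3
    rw [Nat.add_sub_cancel] at h2
    rw [h2, h1, h3, show 2 * j - m - 1 = 2 * j - (m + 1) by omega]
    ring

lemma pe_last (j : ℕ) (hj : 1 ≤ j) (a c α x : ℝ) : pe j a c α x (2 * j + 1) =
    phi c x j * phi a x (j + 1) := by
  rw [← R_eq j hj a c α x, ← pe_j j hj a c α x, split j a c α x (j - 1) (by omega),
    show 2 * j - (j - 1) = j + 1 by omega, show j - 1 + 1 = j by omega, per' _ _ _ _ _ _ hj,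
    uEven_j1, uEven_j, Nat.add_sub_cancel]
  ring

lemma reverse (j : ℕ) (a c α x : ℝ) (hx : pe j a c α x (2 * j + 1) = 0) (m : ℕ) (hm : m ≤ j) :
    (∏ i ∈ Finset.range m, uEven j a c α (2 * j - i)) * pe j a c α x (2 * j - m) =
      pe j a c α x m * pe j a c α x (2 * j) := by
  induction m using Nat.strong_induction_on with
  | _ m ih =>
    match m, ih, hm with
    | 0, _, _ => simp [pe0]
    | 1, _, hm =>
      have h1 := per' j a c α x (2 * j) (by omega)
      rw [hx] at h1
      rw [pe1, ← bEven_symm j a c 0 (by omega)]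
      simp only [Finset.prod_range_one, Nat.sub_zero]
      linear_combination h1
    | m + 2, ih, hm =>
      have i1 := ih (m + 1) (by omega) (by omega)
      have i2 := ih m (by omega) (by omega)
      have h1 := per' j a c α x (2 * j - (m + 1)) (by omega)
      rw [show 2 * j - (m + 1) + 1 = 2 * j - m by omega, bEven_symm j a c (m + 1) (by omega),
        show 2 * j - (m + 1) - 1 = 2 * j - (m + 2) by omega] at h1
      have h2 := per j a c α x m
      have h3 := uEven_symm j a c α (m + 1) (by omega)
      rw [show 2 * j + 1 - (m + 1) = 2 * j - m by omega] at h3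
      rw [Finset.prod_range_succ] at i1 ⊢
      rw [Finset.prod_range_succ]
      rw [h2]
      rw [h3] at i1 ⊢
      set U := ∏ i ∈ Finset.range m, uEven j a c α (2 * j - i)
      linear_combination (U * uEven j a c α (m + 1)) * h1 +
        (x - bEven j a c (m + 1)) * i1 - uEven j a c α (m + 1) * i2

lemma pe_N_a (j : ℕ) (a c α x : ℝ) (hx : pe j a c α x (2 * j + 1) = 0)
    (h : pe j a c α x j ≠ 0) :
    pe j a c α x (2 * j) = ∏ i ∈ Finset.range j, uEven j a c α (2 * j - i) := by
  have := reverse j a c α x hx j le_rfl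
  rw [show 2 * j - j = j by omega] at this
  apply mul_left_cancel₀ h
  linear_combination -this

lemma consec (j : ℕ) (a c α x : ℝ) (n : ℕ) (hu : ∀ i, 1 ≤ i → i ≤ n → uEven j a c α i ≠ 0)
    (h : pe j a c α x (n + 1) = 0) : pe j a c α x n ≠ 0 := by
  induction n with
  | zero => rw [pe0]; exact one_ne_zero
  | succ n ih =>
    intro h0
    have := per j a c α x n
    rw [h, h0, mul_zero, zero_sub] at this
    have h1 : uEven j a c α (n + 1) * pe j a c α x n = 0 := by linarith
    exact (mul_ne_zero (hu (n + 1) (by omega) le_rfl)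
      (ih (fun i h1 h2 => hu i h1 (by omega)) h0)) h1

lemma pe_N_c (j : ℕ) (hj : 1 ≤ j) (a c α x : ℝ)
    (hu : ∀ i, 1 ≤ i → i ≤ 2 * j → uEven j a c α i ≠ 0)
    (hx : pe j a c α x (2 * j + 1) = 0) (h : pe j a c α x j = 0) :
    pe j a c α x (2 * j) = 
      - uEven j a c α j * ∏ i ∈ Finset.range (j - 1), uEven j a c α (2 * j - i) := by
  have := reverse j a c α x hx (j - 1) (by omega)
  rw [show 2 * j - (j - 1) = j + 1 by omega, per' _ _ _ _ _ _ hj, h] at this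
  have h0 : pe j a c α x (j - 1) ≠ 0 := by
    apply consec
    · intro i h1 h2; exact hu i h1 (by omega)
    · rw [show j - 1 + 1 = j by omega, h]
  apply mul_left_cancel₀ h0
  linear_combination -this

lemma u_ne (j : ℕ) (hj : 1 ≤ j) (a c α : ℝ)
    (hα₀ : 0 < α) (hα₁ : α < 1)
    (hcase :
      (-(j : ℝ) < a + c ∧ a + c < -(j : ℝ) + 1 ∧ (a - c < -(j : ℝ) ∨ c - a < -(j : ℝ) + 1)) ∨
      ((a + c < -(2 * (j : ℝ)) + 1 ∨ 0 < a + c) ∧ 0 < c - a ∧ c - a < 1)) (n : ℕ) (h1 : 1 ≤ n)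
      (h2 : n ≤ 2 * j) : uEven j a c α n ≠ 0 := by
  have std : ∀ n : ℕ, 1 ≤ n → n ≤ 2 * j → ustd j a c n ≠ 0 := by
    intro n h1 h2
    have h1' : (1 : ℝ) ≤ n := by exact_mod_cast h1
    have h2' : (n : ℝ) ≤ 2 * j := by exact_mod_cast h2
    have hh : n ≤ j ∨ j + 1 ≤ n := by omega
    have hh' : (n : ℝ) ≤ j ∨ (j : ℝ) + 1 ≤ n := by
      rcases hh with h | h
      · left; exact_mod_cast h
      · right; exact_mod_cast h
    have hq : 2 * (j : ℝ) - 2 * n + 1 ≠ 0 := by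
      rcases hh' with h | h <;> (intro h0; linarith)
    unfold ustd
    apply div_ne_zero _ (by positivity)
    have f1 : a + c + n - 1 ≠ 0 := by
      intro h0
      rcases hcase with ⟨p, q, _⟩ | ⟨p | p, _⟩
      · rcases hh' with h | h <;> linarith
      all_goals linarith
    have f2 : a + c + 2 * j - n ≠ 0 := by
      intro h0
      rcases hcase with ⟨p, q, _⟩ | ⟨p | p, _⟩
      · rcases hh' with h | h <;> linarith
      all_goals linarith
    have f3 : a - c + j - n + 1 ≠ 0 := by
      intro h0
      rcases hcase with ⟨_, _, p | p⟩ | ⟨_, p, q⟩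
      · linarith
      · linarith
      · rcases hh' with h | h <;> linarith
    have f4 : -a + c + j - n ≠ 0 := by
      intro h0
      rcases hcase with ⟨_, _, p | p⟩ | ⟨_, p, q⟩
      · linarith
      · linarith
      · rcases hh' with h | h <;> linarith
    have f5 : (n : ℝ) ≠ 0 := by intro h0; linarith
    have f6 : 2 * (j : ℝ) - n + 1 ≠ 0 := by intro h0; linarith
    positivity
  rcases eq_or_ne n j with h | h
  · subst h
    rw [uEven_j]
    exact mul_ne_zero (by intro h; linarith) (std _ h1 h2)
  rcases eq_or_ne n (j + 1) with h | h
  · subst h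
    rw [uEven_j1]
    exact mul_ne_zero (by intro h; linarith) (std _ hj (by omega))
  rw [uEven_gen _ _ _ _ _ ‹_› h]
  exact std n h1 h2

end PR

namespace PR

lemma poch_zero (z : ℝ) : poch z 0 = 1 := by simp [poch]

lemma poch_add (z : ℝ) (m n : ℕ) : poch z (m + n) = poch z m * poch (z + m) n := by
  unfold poch
  rw [Finset.prod_range_add]
  congr 1
  apply Finset.prod_congr rfl
  intro i _; push_cast; ring

lemma poch_succ (z : ℝ) (n : ℕ) : poch z (n + 1) = poch z n * (z + n) := by
  simp [poch, Finset.prod_range_succ]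

lemma poch_succ' (z : ℝ) (n : ℕ) : poch z (n + 1) = z * poch (z + 1) n := by
  rw [add_comm, poch_add]; simp [poch]

lemma poch_swap (z : ℝ) (s M : ℕ) : poch z s * poch (z + s) M = poch z M * poch (z + M) s := by
  rw [← poch_add, ← poch_add, add_comm]

lemma poch_refl (z : ℝ) (s : ℕ) : poch (1 - z - s) s = (-1) ^ s * poch z s := by
  unfold poch
  rw [← Finset.prod_range_reflect, ← Finset.card_range s, ← Finset.prod_const, Finset.card_range,
    ← Finset.prod_mul_distrib]
  apply Finset.prod_congr rfl
  intro i hi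
  rw [Finset.mem_range] at hi
  rw [Nat.cast_sub (by omega), Nat.cast_sub (by omega)]
  push_cast; ring

lemma poch_one (n : ℕ) : poch 1 n = (Nat.factorial n : ℝ) := by
  induction n with
  | zero => simp [poch]
  | succ n ih => rw [poch_succ, ih, Nat.factorial_succ]; push_cast; ring

lemma poch_ne_of_le (z : ℝ) (s J : ℕ) (h : s ≤ J) (hz : poch z J ≠ 0) : poch z s ≠ 0 := by
  obtain ⟨r, rfl⟩ := Nat.exists_eq_add_of_le h
  rw [poch_add] at hz
  exact left_ne_zero_of_mul hz

lemma poch_factor (z : ℝ) (J i : ℕ) (h : i < J) (hz : poch z J ≠ 0) : z + i ≠ 0 := by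
  unfold poch at hz
  rw [Finset.prod_ne_zero_iff] at hz
  exact hz i (Finset.mem_range.mpr h)

lemma L2 (z : ℝ) (s M : ℕ) :
    poch (z - s) M * poch (1 - z - M) s = poch z M * poch (1 - z) s := by
  have h1 := poch_refl (1 - z) s
  have h2 := poch_refl (z + M - s) s
  rw [show 1 - (1 - z) - (s : ℝ) = z - s by ring] at h1
  rw [show 1 - (z + M - s) - (s : ℝ) = 1 - z - M by ring] at h2
  have h3 := poch_swap (z - s) s M
  rw [show z - s + (s : ℝ) = z by ring, show z - s + (M : ℝ) = z + M - s by ring, h1] at h3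
  have h4 : ((-1 : ℝ) ^ s) * (-1) ^ s = 1 := by rw [← mul_pow]; simp
  rw [h2]
  linear_combination (-(-1) ^ s) * h3 + poch z M * poch (1 - z) s * h4

lemma prod_erase_ite (S : Finset ℕ) (s : ℕ) (f : ℕ → ℝ) :
    ∏ t ∈ S.erase s, f t = ∏ t ∈ S, if t = s then 1 else f t := by
  rw [← Finset.prod_erase S (a := s) (f := fun t => if t = s then 1 else f t) (by simp)]
  apply Finset.prod_congr rfl
  intro t ht
  rw [if_neg (Finset.ne_of_mem_erase ht)]

lemma L3 (J s : ℕ) (h : s ≤ J) :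
    (∏ t ∈ (Finset.range (J + 1)).erase s, ((t : ℝ) - s)) * poch (-(J : ℝ)) s =
      (Nat.factorial s : ℝ) * (Nat.factorial J : ℝ) := by
  obtain ⟨r, rfl⟩ := Nat.exists_eq_add_of_le h
  rw [prod_erase_ite, show s + r + 1 = (s + 1) + r by ring, Finset.prod_range_add,
    Finset.prod_range_succ, if_pos rfl, mul_one]
  have h1 : ∏ x ∈ Finset.range s, (if x = s then 1 else ((x : ℝ) - s)) = poch (-(s : ℝ)) s := by
    apply Finset.prod_congr rfl
    intro i hi
    rw [Finset.mem_range] at hi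
    rw [if_neg (by omega)]; ring
  have h2 : ∏ x ∈ Finset.range r, (if s + 1 + x = s then 1 else (((s + 1 + x : ℕ) : ℝ) - s)) =
      poch 1 r := by
    apply Finset.prod_congr rfl
    intro i hi
    rw [if_neg (by omega)]; push_cast; ring
  rw [h1, h2]
  have h3 := poch_refl 1 s
  rw [show 1 - 1 - (s : ℝ) = -s by ring] at h3
  have h4 := poch_refl (1 + r) s
  rw [show 1 - (1 + (r : ℝ)) - s = -((s + r : ℕ) : ℝ) by push_cast; ring] at h4
  rw [h3, h4, ← poch_one, ← poch_one, show s + r = r + s by ring, poch_add 1 r s]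
  have h5 : ((-1 : ℝ) ^ s) * (-1) ^ s = 1 := by rw [← mul_pow]; simp
  linear_combination poch 1 s * poch 1 r * poch (1 + r) s * h5

lemma L4 (a : ℝ) (J s : ℕ) (h : s ≤ J) (ha : s = 0 ∨ (a ≠ 0 ∧ a + s ≠ 0)) :
    poch (2 * a) s * poch (a + 1) s *
      (∏ t ∈ (Finset.range (J + 1)).erase s, ((t : ℝ) + s + 2 * a)) =
      poch (2 * a + 1) J * poch a s * poch (2 * a + 1 + J) s := by
  have hX : ((s : ℝ) + s + 2 * a) * ∏ t ∈ (Finset.range (J + 1)).erase s, ((t : ℝ) + s + 2 * a) =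
      poch (2 * a + s) (J + 1) := by
    rw [Finset.mul_prod_erase (Finset.range (J + 1)) (fun t : ℕ => (t : ℝ) + s + 2 * a)
      (Finset.mem_range.mpr (by omega))]
    apply Finset.prod_congr rfl
    intro t _; ring
  rcases ha with rfl | ⟨h1, h2⟩
  · rw [prod_erase_ite, Finset.prod_range_succ']
    simp only [poch_zero, if_true, mul_one, one_mul]
    apply Finset.prod_congr rfl
    intro t _
    rw [if_neg (by omega)]; push_cast; ring
  · have e1 := poch_swap (2 * a) s (J + 1)
    rw [poch_succ' (2 * a) J] at e1
    have e2 : a * poch (a + 1) s = poch a s * (a + s) := by rw [← poch_succ', poch_succ]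
    rw [show 2 * a + ((J + 1 : ℕ) : ℝ) = 2 * a + 1 + J by push_cast; ring, ← hX] at e1
    set X := ∏ t ∈ (Finset.range (J + 1)).erase s, ((t : ℝ) + s + 2 * a)
    have h3 : 2 * a * (a + s) ≠ 0 := by positivity
    apply mul_left_cancel₀ h3
    linear_combination a * poch (a + 1) s * e1 +
      2 * a * poch (2 * a + 1) J * poch (2 * a + 1 + J) s * e2

lemma weight_core (a c : ℝ) (J M s : ℕ) (h : s ≤ J) (ha : s = 0 ∨ (a ≠ 0 ∧ a + s ≠ 0)) :
    poch (-(J : ℝ)) s * poch (2 * a) s * poch (a + 1) s * poch (a - c - M + 1) s * poch (a + c) s *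
      ((∏ t ∈ (Finset.range (J + 1)).erase s, (((t : ℝ) + a) ^ 2 - (s + a) ^ 2)) *
       (∏ t ∈ Finset.range M, (((t : ℝ) + c) ^ 2 - (s + a) ^ 2))) =
      (Nat.factorial J) * poch (a + c) M * poch (c - a) M * poch (2 * a + 1) J
        * poch a s * (Nat.factorial s) * poch (2 * a + 1 + J) s
        * poch (a - c + 1) s * poch (a + c + M) s := by
  have f1 : (∏ t ∈ (Finset.range (J + 1)).erase s, (((t : ℝ) + a) ^ 2 - (s + a) ^ 2)) =
      (∏ t ∈ (Finset.range (J + 1)).erase s, ((t : ℝ) - s)) *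
      (∏ t ∈ (Finset.range (J + 1)).erase s, ((t : ℝ) + s + 2 * a)) := by
    rw [← Finset.prod_mul_distrib]
    apply Finset.prod_congr rfl
    intro t _; ring
  have f2 : (∏ t ∈ Finset.range M, (((t : ℝ) + c) ^ 2 - (s + a) ^ 2)) =
      poch (c - a - s) M * poch (a + c + s) M := by
    unfold poch
    rw [← Finset.prod_mul_distrib]
    apply Finset.prod_congr rfl
    intro t _; ring
  have e1 := L3 J s h
  have e2 := L4 a J s h ha
  have e3 := L2 (c - a) s M
  have e4 := poch_swap (a + c) s M
  rw [show 1 - (c - a) - (M : ℝ) = a - c - M + 1 by ring, show 1 - (c - a) = a - c + 1 by ring] at e3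
  rw [f1, f2]
  set X := (∏ t ∈ (Finset.range (J + 1)).erase s, ((t : ℝ) - s))
  set Y := (∏ t ∈ (Finset.range (J + 1)).erase s, ((t : ℝ) + s + 2 * a))
  calc _ = (X * poch (-(J : ℝ)) s) * (poch (2 * a) s * poch (a + 1) s * Y) *
        (poch (c - a - s) M * poch (a - c - M + 1) s) * (poch (a + c) s * poch (a + c + s) M) := by
        ring
    _ = _ := by rw [e1, e2, e3, e4]; ring

lemma prod_range_odd (j : ℕ) (f : ℕ → ℝ) : ∏ t ∈ Finset.range (2 * j + 1), f t =
    (∏ t ∈ Finset.range (j + 1), f (2 * t)) * ∏ t ∈ Finset.range j, f (2 * t + 1) := by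
  induction j with
  | zero => simp
  | succ j ih =>
    rw [show 2 * (j + 1) + 1 = 2 * j + 1 + 1 + 1 by ring, Finset.prod_range_succ,
      Finset.prod_range_succ, ih, Finset.prod_range_succ (fun t => f (2 * t)) (j + 1),
      Finset.prod_range_succ (fun t => f (2 * t + 1)) j]
    rw [show 2 * (j + 1) = 2 * j + 1 + 1 by ring]
    ring

lemma bi_even (a c : ℝ) (s : ℕ) : biLattice a c (2 * s) = -((s : ℝ) + a) ^ 2 := by
  simp [biLattice]

lemma bi_odd (a c : ℝ) (s : ℕ) : biLattice a c (2 * s + 1) = -((s : ℝ) + c) ^ 2 := by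
  have h1 : (2 * s + 1) % 2 = 1 := by omega
  have h2 : (2 * s + 1) / 2 = s := by omega
  simp [biLattice, h1, h2]

lemma erase_even (j s : ℕ) (a c : ℝ) :
    ∏ t ∈ (Finset.range (2 * j + 1)).erase (2 * s), (biLattice a c (2 * s) - biLattice a c t) =
      (∏ t ∈ (Finset.range (j + 1)).erase s, (((t : ℝ) + a) ^ 2 - (s + a) ^ 2)) *
       (∏ t ∈ Finset.range j, (((t : ℝ) + c) ^ 2 - (s + a) ^ 2)) := by
  rw [prod_erase_ite, prod_range_odd, prod_erase_ite]
  congr 1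
  · apply Finset.prod_congr rfl
    intro t _
    by_cases h : t = s
    · simp [h]
    · rw [if_neg (by omega), if_neg h, bi_even, bi_even]; ring
  · apply Finset.prod_congr rfl
    intro t _
    rw [if_neg (by omega), bi_even, bi_odd]; ring

lemma erase_odd (j s : ℕ) (hj : 1 ≤ j) (a c : ℝ) :
    ∏ t ∈ (Finset.range (2 * j + 1)).erase (2 * s + 1),
        (biLattice a c (2 * s + 1) - biLattice a c t) =
      (∏ t ∈ (Finset.range (j - 1 + 1)).erase s, (((t : ℝ) + c) ^ 2 - (s + c) ^ 2)) *
       (∏ t ∈ Finset.range (j + 1), (((t : ℝ) + a) ^ 2 - (s + c) ^ 2)) := by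
  rw [prod_erase_ite, prod_range_odd, prod_erase_ite, mul_comm, show j - 1 + 1 = j by omega]
  congr 1
  · apply Finset.prod_congr rfl
    intro t _
    by_cases h : t = s
    · simp [h]
    · rw [if_neg (by omega), if_neg h, bi_odd, bi_odd]; ring
  · apply Finset.prod_congr rfl
    intro t _
    rw [if_neg (by omega), bi_even, bi_odd]; ring

lemma double_fact (j : ℕ) : (Nat.factorial (2 * j) : ℝ) * (Nat.choose (2 * j) j : ℝ) =
    ∏ i ∈ Finset.range j, (4 * (2 * (i : ℝ) + 1) ^ 2) := by
  induction j with
  | zero => simp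
  | succ j ih =>
    rw [Finset.prod_range_succ, ← ih]
    have h := Nat.succ_mul_centralBinom_succ j
    unfold Nat.centralBinom at h
    have h' : ((j : ℝ) + 1) * (Nat.choose (2 * (j + 1)) (j + 1) : ℝ) =
        2 * (2 * j + 1) * (Nat.choose (2 * j) j : ℝ) := by exact_mod_cast h
    have hf : (Nat.factorial (2 * (j + 1)) : ℝ) =
        (2 * j + 2) * (2 * j + 1) * (Nat.factorial (2 * j) : ℝ) := by
      rw [show 2 * (j + 1) = 2 * j + 1 + 1 by ring, Nat.factorial_succ, Nat.factorial_succ]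
      push_cast; ring
    rw [hf]
    linear_combination 2 * (2 * (j : ℝ) + 1) * (Nat.factorial (2 * j) : ℝ) * h'

lemma kappa_eq (j : ℕ) (a c : ℝ) :
    ∏ i ∈ Finset.range j, ustd j a c (i + 1) = kappaEven j a c := by
  have h1 : ∏ i ∈ Finset.range j, ustd j a c (i + 1) =
      (∏ i ∈ Finset.range j, ((1 : ℝ) + i)) * (∏ i ∈ Finset.range j, (a + c + i)) *
      (∏ i ∈ Finset.range j, ((2 * (j : ℝ) - i) * (a - c + j - i) * (c - a + j - i - 1) *
        (a + c + 2 * j - i - 1) / (4 * (2 * (j : ℝ) - 2 * i - 1) ^ 2))) := by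
    rw [← Finset.prod_mul_distrib, ← Finset.prod_mul_distrib]
    apply Finset.prod_congr rfl
    intro i _
    unfold ustd
    push_cast
    rw [show 2 * (j : ℝ) - 2 * (i + 1) + 1 = 2 * j - 2 * i - 1 by ring]
    ring
  have h2 : (∏ i ∈ Finset.range j, ((2 * (j : ℝ) - i) * (a - c + j - i) * (c - a + j - i - 1) *
        (a + c + 2 * j - i - 1) / (4 * (2 * (j : ℝ) - 2 * i - 1) ^ 2))) =
      poch (1 + j) j * poch (a - c + 1) j * poch (c - a) j * poch (a + c + j) j /
      ∏ i ∈ Finset.range j, (4 * (2 * (i : ℝ) + 1) ^ 2) := by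
    unfold poch
    rw [← Finset.prod_mul_distrib, ← Finset.prod_mul_distrib, ← Finset.prod_mul_distrib,
      ← Finset.prod_div_distrib, ← Finset.prod_range_reflect]
    apply Finset.prod_congr rfl
    intro i hi
    rw [Finset.mem_range] at hi
    rw [Nat.cast_sub (by omega), Nat.cast_sub (by omega)]
    push_cast
    congr 1 <;> ring
  have h3 := poch_refl (c - a) j
  rw [show 1 - (c - a) - (j : ℝ) = a - c - j + 1 by ring] at h3
  have hC : (Nat.choose (2 * j) j : ℝ) ≠ 0 := by
    exact_mod_cast (Nat.choose_pos (by omega)).ne'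
  have hF : (Nat.factorial (2 * j) : ℝ) ≠ 0 := by exact_mod_cast Nat.factorial_ne_zero _
  have hF2 : poch 1 j * poch (1 + j) j = (Nat.factorial (2 * j) : ℝ) := by
    rw [← poch_add, poch_one, two_mul]
  rw [h1, h2, ← double_fact]
  change poch 1 j * poch (a + c) j * _ = _
  unfold kappaEven
  rw [two_mul j, poch_add (a - c - j + 1), poch_add (a + c), h3,
    show a - c - (j : ℝ) + 1 + j = a - c + 1 by ring, ← two_mul j, ← hF2]
  rw [← hF2] at hF
  have g1 := left_ne_zero_of_mul hF
  have g2 := right_ne_zero_of_mul hF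
  have g3 : ((-1 : ℝ) ^ j) ≠ 0 := by simp
  field_simp

end PR

namespace PR

lemma deg_coeff (b u : ℕ → ℝ) (n : ℕ) :
    ((monicOPS b u n).2.natDegree ≤ n ∧ (monicOPS b u n).2.coeff n = 1) ∧
    ((monicOPS b u (n + 1)).2.natDegree ≤ n + 1 ∧ (monicOPS b u (n + 1)).2.coeff (n + 1) = 1) := by
  induction n with
  | zero => simp [monicOPS]
  | succ n ih =>
    obtain ⟨⟨h1, h2⟩, h3, h4⟩ := ih
    refine ⟨⟨h3, h4⟩, ?_⟩
    have e : (monicOPS b u (n + 1 + 1)).2 = (X - C (b (n + 1))) * (monicOPS b u (n + 1)).2 -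
      C (u (n + 1)) * (monicOPS b u n).2 := rfl
    rw [e]
    constructor
    · refine (natDegree_sub_le _ _).trans (max_le ?_ ?_)
      · refine natDegree_mul_le.trans ?_
        have := natDegree_X_sub_C_le (b (n + 1))
        omega
      · exact (natDegree_C_mul_le _ _).trans (by omega)
    · rw [coeff_sub, coeff_C_mul, sub_mul, coeff_sub, coeff_X_mul, coeff_C_mul, h4,
        coeff_eq_zero_of_natDegree_lt (by omega : (monicOPS b u (n + 1)).2.natDegree < n + 1 + 1),
        coeff_eq_zero_of_natDegree_lt (by omega : (monicOPS b u n).2.natDegree < n + 1 + 1)]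
      ring

lemma P_sum (j : ℕ) (a c α : ℝ) (hdist : ∀ s t : ℕ, s ≤ 2 * j → t ≤ 2 * j →
      biLattice a c s = biLattice a c t → s = t) (m : ℕ) (hm : m ≤ 2 * j) :
    ∑ s ∈ Finset.range (2 * j + 1), pe j a c α (biLattice a c s) m /
      ∏ t ∈ (Finset.range (2 * j + 1)).erase s, (biLattice a c s - biLattice a c t) =
      if 2 * j = m then 1 else 0 := by
  have hd := (deg_coeff (bEven j a c) (uEven j a c α) m).1
  have hinj : Set.InjOn (biLattice a c) (Finset.range (2 * j + 1) : Finset ℕ) := by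
    intro s hs t ht h
    simp only [Finset.coe_range, Set.mem_Iio] at hs ht
    exact hdist s t (by omega) (by omega) h
  have := Lagrange.coeff_eq_sum (P := paraRacahEven j a c α m) hinj (by
    rw [Finset.card_range]
    refine lt_of_le_of_lt degree_le_natDegree ?_
    have h1 : (paraRacahEven j a c α m).natDegree ≤ m := hd.1
    exact_mod_cast (by omega : (paraRacahEven j a c α m).natDegree < 2 * j + 1))
  unfold pe
  rw [← this, Finset.card_range, Nat.add_sub_cancel]
  split_ifs with h
  · subst h; exact hd.2
  · exact coeff_eq_zero_of_natDegree_lt (lt_of_le_of_lt hd.1 (by omega))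

lemma w_even (j : ℕ) (hj : 1 ≤ j) (a c α : ℝ)
    (hp₁ : poch (a + c) (j + 1) ≠ 0) (hp₂ : poch (c - a) j ≠ 0)
    (hp₄ : poch (2 * a + 1) j ≠ 0)
    (hp₆ : poch a j ≠ 0)
    (hp₇ : poch (2 * a + 1 + j) j ≠ 0) (hp₈ : poch (a - c + 1) j ≠ 0)
    (hp₉ : poch (a + c + j) j ≠ 0) (s : ℕ) (hs : s ≤ j) :
    wEven j a c α (2 * s) * ∏ t ∈ (Finset.range (2 * j + 1)).erase (2 * s),
      (biLattice a c (2 * s) - biLattice a c t) = 2 * (1 - α) * kappaEven j a c := by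
  have ha : a ≠ 0 := by simpa using poch_factor a j 0 (by omega) hp₆
  have has : a + s ≠ 0 := by
    rcases Nat.lt_or_ge s j with h | h
    · exact poch_factor a j s h hp₆
    · obtain rfl : s = j := by omega
      have := poch_factor _ s (s - 1) (by omega) hp₇
      intro h0
      apply this
      rw [Nat.cast_sub hj]; push_cast; linarith
  have core := weight_core a c j j s hs (Or.inr ⟨ha, has⟩)
  rw [erase_even]
  unfold wEven
  rw [if_pos (by omega), show 2 * s / 2 = s by omega, div_mul_eq_mul_div, div_eq_iff]
  · linear_combination 2 * (1 - α) * kappaEven j a c * core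
  · have q1 := poch_ne_of_le _ j _ (by omega) hp₁
    have q2 := poch_ne_of_le _ s _ hs hp₆
    have q3 := poch_ne_of_le _ s _ hs hp₇
    have q4 := poch_ne_of_le _ s _ hs hp₈
    have q5 := poch_ne_of_le _ s _ hs hp₉
    have q6 : (Nat.factorial j : ℝ) ≠ 0 := by exact_mod_cast Nat.factorial_ne_zero _
    have q7 : (Nat.factorial s : ℝ) ≠ 0 := by exact_mod_cast Nat.factorial_ne_zero _
    positivity

lemma w_odd (j : ℕ) (hj : 1 ≤ j) (a c α : ℝ)
    (hp₁ : poch (a + c) (j + 1) ≠ 0)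
    (hp₃ : poch (a - c) (j + 1) ≠ 0)
    (hp₅ : poch (2 * c + 1) (j - 1) ≠ 0) (hp₁₀ : poch c (j - 1) ≠ 0)
    (hp₁₁ : poch (2 * c + j) (j - 1) ≠ 0) (hp₁₂ : poch (c - a + 1) (j - 1) ≠ 0)
    (hp₁₃ : poch (a + c + j + 1) (j - 1) ≠ 0) (s : ℕ) (hs : s < j) :
    wEven j a c α (2 * s + 1) * ∏ t ∈ (Finset.range (2 * j + 1)).erase (2 * s + 1),
      (biLattice a c (2 * s + 1) - biLattice a c t) = -2 * α * kappaEven j a c := by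
  have hc : s = 0 ∨ (c ≠ 0 ∧ c + s ≠ 0) := by
    rcases Nat.eq_zero_or_pos s with h | h
    · exact Or.inl h
    · right
      refine ⟨by simpa using poch_factor c (j - 1) 0 (by omega) hp₁₀, ?_⟩
      rcases Nat.lt_or_ge s (j - 1) with h | h
      · exact poch_factor c (j - 1) s h hp₁₀
      · obtain rfl : j = s + 1 := by omega
        have := poch_factor _ (s + 1 - 1) (s - 1) (by omega) hp₁₁
        intro h0
        apply this
        rw [Nat.cast_sub (by omega)]; push_cast; linarith
  have core := weight_core c a (j - 1) (j + 1) s (by omega) hc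
  have c1 : ((j - 1 : ℕ) : ℝ) = j - 1 := by rw [Nat.cast_sub hj]; push_cast; ring
  rw [c1, show ((j + 1 : ℕ) : ℝ) = j + 1 by push_cast; ring,
    show -((j : ℝ) - 1) = -(j : ℝ) + 1 by ring, show c - a - ((j : ℝ) + 1) + 1 = c - a - j by ring,
    show c + a = a + c by ring, show 2 * c + 1 + ((j : ℝ) - 1) = 2 * c + j by ring,
    show a + c + ((j : ℝ) + 1) = a + c + j + 1 by ring] at core
  rw [erase_odd _ _ hj]
  unfold wEven
  rw [if_neg (by omega), show (2 * s + 1) / 2 = s by omega, div_mul_eq_mul_div, div_eq_iff]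
  · linear_combination (-2) * α * kappaEven j a c * core
  · have hs' : s ≤ j - 1 := by omega
    have q2 := poch_ne_of_le _ s _ hs' hp₁₀
    have q3 := poch_ne_of_le _ s _ hs' hp₁₁
    have q4 := poch_ne_of_le _ s _ hs' hp₁₂
    have q5 := poch_ne_of_le _ s _ hs' hp₁₃
    have q6 : (Nat.factorial (j - 1) : ℝ) ≠ 0 := by exact_mod_cast Nat.factorial_ne_zero _
    have q7 : (Nat.factorial s : ℝ) ≠ 0 := by exact_mod_cast Nat.factorial_ne_zero _
    positivity

lemma prod_Icc_eq (u : ℕ → ℝ) (n : ℕ) :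
    ∏ i ∈ Finset.Icc 1 n, u i = ∏ i ∈ Finset.range n, u (i + 1) := by
  induction n with
  | zero => simp
  | succ n ih => rw [Finset.prod_Icc_succ_top (by omega), ih, Finset.prod_range_succ]

lemma H_low (j : ℕ) (hj : 1 ≤ j) (a c α : ℝ) :
    ∏ i ∈ Finset.range j, uEven j a c α (i + 1) = 2 * (1 - α) * kappaEven j a c := by
  obtain ⟨m, rfl⟩ : ∃ m, j = m + 1 := ⟨j - 1, by omega⟩
  rw [← kappa_eq, Finset.prod_range_succ, Finset.prod_range_succ, uEven_j,
    Finset.prod_congr rfl (fun i hi => ?_)]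
  · ring
  · rw [Finset.mem_range] at hi
    exact uEven_gen _ _ _ _ _ (by omega) (by omega)

lemma H_N (j : ℕ) (hj : 1 ≤ j) (a c α : ℝ) :
    ∏ i ∈ Finset.Icc 1 (2 * j), uEven j a c α i =
      2 * (1 - α) * kappaEven j a c * ∏ i ∈ Finset.range j, uEven j a c α (2 * j - i) := by
  rw [prod_Icc_eq, two_mul j, Finset.prod_range_add, H_low j hj,
    ← Finset.prod_range_reflect (fun i => uEven j a c α (j + i + 1))]
  congr 1
  apply Finset.prod_congr rfl
  intro i hi
  rw [Finset.mem_range] at hi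
  congr 1; omega

lemma favard (j : ℕ) (a c α : ℝ) (y w : ℕ → ℝ)
    (hu : ∀ i, 1 ≤ i → i ≤ 2 * j → uEven j a c α i ≠ 0)
    (hy : ∀ s ∈ Finset.range (2 * j + 1), pe j a c α (y s) (2 * j + 1) = 0)
    (hN : ∀ m ≤ 2 * j, ∑ s ∈ Finset.range (2 * j + 1),
      pe j a c α (y s) (2 * j) * pe j a c α (y s) m * w s =
        (∏ i ∈ Finset.Icc 1 (2 * j), uEven j a c α i) * (if 2 * j = m then 1 else 0)) :
    ∀ n m : ℕ, n ≤ 2 * j → m ≤ 2 * j →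
      ∑ s ∈ Finset.range (2 * j + 1), pe j a c α (y s) n * pe j a c α (y s) m * w s =
        (∏ i ∈ Finset.Icc 1 n, uEven j a c α i) * (if n = m then 1 else 0) := by
  set B : ℕ → ℕ → ℝ := fun n m => 
    ∑ s ∈ Finset.range (2 * j + 1), pe j a c α (y s) n * pe j a c α (y s) m * w s with hB
  have hz : ∀ n, B n (2 * j + 1) = 0 := by
    intro n
    apply Finset.sum_eq_zero
    intro s hs
    rw [hy s hs]; ring
  have hz' : ∀ n, B (2 * j + 1) n = 0 := by
    intro n
    apply Finset.sum_eq_zero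
    intro s hs
    rw [hy s hs]; ring
  -- recurrence
  have hr0 : ∀ n, uEven j a c α (n + 1) * B n 0 = B (n + 1) 1 + bEven j a c 0 * B (n + 1) 0
      - B (n + 2) 0 - bEven j a c (n + 1) * B (n + 1) 0 := by
    intro n
    simp only [hB, Finset.mul_sum, ← Finset.sum_add_distrib, ← Finset.sum_sub_distrib]
    apply Finset.sum_congr rfl
    intro s _
    rw [per, pe1, pe0]; ring
  have hr : ∀ n m, uEven j a c α (n + 1) * B n (m + 1) = B (n + 1) (m + 2)
      + bEven j a c (m + 1) * B (n + 1) (m + 1) + uEven j a c α (m + 1) * B (n + 1) m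
      - B (n + 2) (m + 1) - bEven j a c (n + 1) * B (n + 1) (m + 1) := by
    intro n m
    simp only [hB, Finset.mul_sum, ← Finset.sum_add_distrib, ← Finset.sum_sub_distrib]
    apply Finset.sum_congr rfl
    intro s _
    rw [per, per]; ring
  have claim : ∀ d n, n + d = 2 * j →
      (∀ m ≤ 2 * j, B n m = (∏ i ∈ Finset.Icc 1 n, uEven j a c α i) * (if n = m then 1 else 0)) ∧
      (∀ m ≤ 2 * j, B (n + 1) m =
        (∏ i ∈ Finset.Icc 1 (n + 1), uEven j a c α i) * (if n + 1 = m then 1 else 0)) := by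
    intro d
    induction d with
    | zero =>
      intro n hn
      obtain rfl : n = 2 * j := by omega
      refine ⟨hN, ?_⟩
      intro m hm
      rw [hz', if_neg (by omega), mul_zero]
    | succ d ih =>
      intro n hn
      obtain ⟨i1, i2⟩ := ih (n + 1) (by omega)
      refine ⟨?_, i1⟩
      have i1' : ∀ m ≤ 2 * j + 1, B (n + 1) m =
          (∏ i ∈ Finset.Icc 1 (n + 1), uEven j a c α i) * (if n + 1 = m then 1 else 0) := by
        intro m hm
        rcases Nat.lt_or_ge m (2 * j + 1) with h | h
        · exact i1 m (by omega)
        · obtain rfl : m = 2 * j + 1 := by omega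
          rw [hz, if_neg (by omega), mul_zero]
      intro m hm
      apply mul_left_cancel₀ (hu (n + 1) (by omega) (by omega))
      rw [Finset.prod_Icc_succ_top (by omega)] at i1'
      rw [Finset.prod_Icc_succ_top (by omega), Finset.prod_Icc_succ_top (by omega)] at i2
      set H := ∏ i ∈ Finset.Icc 1 n, uEven j a c α i
      cases m with
      | zero =>
        rw [hr0, i1' 1 (by omega), i1' 0 (by omega), i2 0 (by omega)]
        rcases eq_or_ne n 0 with h | h
        · subst h; simp; ring
        · simp [h]
      | succ m =>
        rw [hr, i1' (m + 2) (by omega), i1' (m + 1) (by omega), i1' m (by omega),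
          i2 (m + 1) (by omega)]
        rcases eq_or_ne n m with h | h
        · subst h; simp
        · rcases eq_or_ne n (m + 1) with h' | h'
          · subst h'
            have z : ¬ (m + 1 + 1 = m) := by omega
            have z' : ¬ (2 + m = m) := by omega
            simp [z]; try ring_nf
            try simp [z, z']
          · rcases eq_or_ne (n + 1) m with h'' | h''
            · subst h''; simp [h']; try ring
            · simp [h, h', h'']
  intro n m hn hm
  exact (claim (2 * j - n) n (by omega)).1 m hm

lemma phi_root (A x : ℝ) (k s : ℕ) (h : s < k) (hx : x = -((s : ℝ) + A) ^ 2) : phi A x k = 0 := by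
  apply Finset.prod_eq_zero (Finset.mem_range.mpr h)
  rw [hx]; ring

lemma root_all (j : ℕ) (hj : 1 ≤ j) (a c α : ℝ) (s : ℕ) (hs : s < 2 * j + 1) :
    pe j a c α (biLattice a c s) (2 * j + 1) = 0 := by
  rw [pe_last j hj]
  rcases Nat.even_or_odd' s with ⟨t, rfl | rfl⟩
  · rw [phi_root a _ (j + 1) t (by omega) (bi_even a c t), mul_zero]
  · rw [phi_root c _ j t (by omega) (bi_odd a c t), zero_mul]

end PR

theorem paraRacahEven_orthogonality (j : ℕ) (hj : 1 ≤ j) (a c α : ℝ)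
    (hα₀ : 0 < α) (hα₁ : α < 1)
    (hcase :
      (-(j : ℝ) < a + c ∧ a + c < -(j : ℝ) + 1 ∧ (a - c < -(j : ℝ) ∨ c - a < -(j : ℝ) + 1)) ∨
      ((a + c < -(2 * (j : ℝ)) + 1 ∨ 0 < a + c) ∧ 0 < c - a ∧ c - a < 1))
    (hdist : ∀ s t : ℕ, s ≤ 2 * j → t ≤ 2 * j →
      biLattice a c s = biLattice a c t → s = t)
    (hp₁ : poch (a + c) (j + 1) ≠ 0) (hp₂ : poch (c - a) j ≠ 0)
    (hp₃ : poch (a - c) (j + 1) ≠ 0) (hp₄ : poch (2 * a + 1) j ≠ 0)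
    (hp₅ : poch (2 * c + 1) (j - 1) ≠ 0) (hp₆ : poch a j ≠ 0)
    (hp₇ : poch (2 * a + 1 + j) j ≠ 0) (hp₈ : poch (a - c + 1) j ≠ 0)
    (hp₉ : poch (a + c + j) j ≠ 0) (hp₁₀ : poch c (j - 1) ≠ 0)
    (hp₁₁ : poch (2 * c + j) (j - 1) ≠ 0) (hp₁₂ : poch (c - a + 1) (j - 1) ≠ 0)
    (hp₁₃ : poch (a + c + j + 1) (j - 1) ≠ 0) :
    ∀ n m : ℕ, n ≤ 2 * j → m ≤ 2 * j →
      ∑ s ∈ Finset.range (2 * j + 1),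
          (paraRacahEven j a c α n).eval (biLattice a c s) *
            (paraRacahEven j a c α m).eval (biLattice a c s) * wEven j a c α s =
        (∏ i ∈ Finset.Icc 1 n, uEven j a c α i) * (if n = m then 1 else 0) := by
  have hu := fun i => PR.u_ne j hj a c α hα₀ hα₁ hcase i
  have hE : ∀ s < 2 * j + 1, ∏ t ∈ (Finset.range (2 * j + 1)).erase s,
      (biLattice a c s - biLattice a c t) ≠ 0 := by
    intro s hs
    rw [Finset.prod_ne_zero_iff]
    intro t ht h0
    rw [Finset.mem_erase, Finset.mem_range] at ht
    exact ht.1 (hdist t s (by omega) (by omega) (sub_eq_zero.mp h0).symm)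
  have hw : ∀ s < 2 * j + 1, PR.pe j a c α (biLattice a c s) (2 * j) * wEven j a c α s =
      (∏ i ∈ Finset.Icc 1 (2 * j), uEven j a c α i) /
        ∏ t ∈ (Finset.range (2 * j + 1)).erase s, (biLattice a c s - biLattice a c t) := by
    intro s hs
    rw [eq_div_iff (hE s hs), PR.H_N j hj]
    have hroot := PR.root_all j hj a c α s hs
    rcases Nat.even_or_odd' s with ⟨t, rfl | rfl⟩
    · rw [mul_assoc, PR.w_even j hj a c α hp₁ hp₂ hp₄ hp₆ hp₇ hp₈ hp₉ t (by omega),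
        PR.pe_N_a j a c α _ hroot]
      · ring
      · rw [PR.pe_j j hj, PR.phi, Finset.prod_ne_zero_iff]
        intro i hi h0
        rw [Finset.mem_range] at hi
        have := hdist (2 * t) (2 * i + 1) (by omega) (by omega) (by
          rw [PR.bi_odd]; linarith)
        omega
    · rw [mul_assoc, PR.w_odd j hj a c α hp₁ hp₃ hp₅ hp₁₀ hp₁₁ hp₁₂ hp₁₃ t (by omega),
        PR.pe_N_c j hj a c α _ hu hroot]
      · have e : ∏ i ∈ Finset.range j, uEven j a c α (2 * j - i) =
            (∏ i ∈ Finset.range (j - 1), uEven j a c α (2 * j - i)) * uEven j a c α (j + 1) := by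
          conv_lhs => rw [show Finset.range j = Finset.range (j - 1 + 1) by congr 1; omega]
          rw [Finset.prod_range_succ]
          congr 2; omega
        rw [e, PR.uEven_j1, PR.uEven_j]
        ring
      · rw [PR.pe_j j hj, PR.phi_root c _ j t (by omega) (PR.bi_odd a c t)]
  refine PR.favard j a c α (biLattice a c) (wEven j a c α) hu
    (fun s hs => PR.root_all j hj a c α s (Finset.mem_range.mp hs)) ?_
  intro m hm
  rw [← PR.P_sum j a c α hdist m hm, Finset.mul_sum]
  apply Finset.sum_congr rfl
  intro s hs
  rw [mul_right_comm, hw s (Finset.mem_range.mp hs)]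
  ring
end
end

section
/- Assume 0 < α < 1, either (-j < a + c < -j + 1 and (a - c < -j or c - a < -j + 1)) or ((a + c < -N + 1 or 0 < a + c) and 0 < c - a < 1), and that the Pochhammer symbols (a+c)_{j+1}, (c-a)_j, (a-c)_{j+1}, (2a+1)_j, (2c+1)_{j-1}, (a)_j, (2a+1+j)_j, (a-c+1)_j, (a+c+j)_j, (c)_{j-1}, (2c+j)_{j-1}, (c-a+1)_{j-1}, (a+c+j+1)_{j-1} are all nonzero. Then the even-case para-Racah weights satisfy Σ_{s=0}^{j} w_{2s} = 1 - α and Σ_{s=0}^{j-1} w_{2s+1} = α. -/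
open Filter Topology Polynomial

noncomputable section

theorem poch_zero' (z : ℝ) : poch z 0 = 1 := by simp [poch]

theorem poch_succ' (z : ℝ) (k : ℕ) : poch z (k + 1) = poch z k * (z + k) := by
  simp [poch, Finset.prod_range_succ]

theorem poch_add' (z : ℝ) (m k : ℕ) : poch z (m + k) = poch z m * poch (z + m) k := by
  induction k with
  | zero => simp [poch_zero']
  | succ k ih =>
    rw [← add_assoc, poch_succ', ih, poch_succ']; push_cast; ring

theorem poch_succ_left' (z : ℝ) (k : ℕ) : poch z (k + 1) = z * poch (z + 1) k := by
  rw [add_comm, poch_add']; simp [poch]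

theorem poch_ne_le {z : ℝ} {m k : ℕ} (h : poch z k ≠ 0) (hm : m ≤ k) : poch z m ≠ 0 := by
  obtain ⟨d, rfl⟩ := Nat.exists_eq_add_of_le hm
  rw [poch_add'] at h
  exact left_ne_zero_of_mul h

theorem poch_neg_self (n : ℕ) : poch (-(n : ℝ)) (n + 1) = 0 := by
  rw [poch_succ']; simp

theorem poch_reflect (z : ℝ) (k : ℕ) : poch (-z - k + 1) k = (-1) ^ k * poch z k := by
  induction k with
  | zero => simp [poch_zero']
  | succ k ih =>
    rw [poch_succ_left', poch_succ']
    have : -z - ((k + 1 : ℕ) : ℝ) + 1 + 1 = -z - k + 1 := by push_cast; ring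
    rw [this, ih]; push_cast; ring

theorem poch_fact (m k : ℕ) : poch ((m : ℝ) + 1) k * (m.factorial : ℝ) = ((m + k).factorial : ℝ) := by
  induction k with
  | zero => simp [poch_zero']
  | succ k ih =>
    rw [poch_succ', ← add_assoc, Nat.factorial_succ]; push_cast; rw [← ih]; ring

/-- summand of the terminating very-well-poised 5F4 -/
def vterm (n : ℕ) (e B C D E : ℝ) (s : ℕ) : ℝ :=
  poch (-(n : ℝ)) s * poch (2 * e) s * poch (e + 1) s * poch B s * poch C s /
    (poch e s * (Nat.factorial s) * poch (2 * e + 1 + n) s * poch D s * poch E s)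

theorem vterm_tele (n : ℕ) (e B C D E : ℝ) (hD : D = 1 + 2 * e - B) (hE : E = 1 + 2 * e - C)
    (m : ℕ) (he : poch e m ≠ 0) (h1 : poch (2 * e + 1 + n) (m + 1) ≠ 0)
    (h3 : poch D m ≠ 0) (h4 : poch E m ≠ 0) :
    ∑ s ∈ Finset.range (m + 1), ((D + n) * (E + n) * vterm (n + 1) e B C D E s
      - (1 + 2 * e + n) * (D - C + n) * vterm n e B C D E s) =
    poch (-(n : ℝ)) m * poch (2 * e + 1) m * poch B (m + 1) * poch C (m + 1) /
      (poch (2 * e + 2 + n) m * m.factorial * poch D m * poch E m) := by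
  induction m with
  | zero =>
    simp [vterm, poch_zero', poch_succ', hD, hE]; ring
  | succ m ih =>
    rw [Finset.sum_range_succ, ih (poch_ne_le he (by omega)) (poch_ne_le h1 (by omega))
      (poch_ne_le h3 (by omega)) (poch_ne_le h4 (by omega))]
    have he0 : e ≠ 0 := by
      rw [poch_succ_left'] at he; exact left_ne_zero_of_mul he
    have hr : poch (e + 1) (m + 1) = poch e (m + 1) * (e + m + 1) / e := by
      rw [eq_div_iff he0, mul_comm, ← poch_succ_left', poch_succ']; push_cast; ring
    have e1 : 2 * e + 1 + (n : ℝ) + 1 = 2 * e + 2 + n := by ring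
    have e2 : 2 * e + 1 + ((n + 1 : ℕ) : ℝ) = 2 * e + 2 + n := by push_cast; ring
    have e3 : -((n + 1 : ℕ) : ℝ) + 1 = -(n : ℝ) := by push_cast; ring
    unfold vterm
    rw [hr, e2, poch_succ_left' (2 * e + 1 + n) m, e1, poch_succ_left' (-((n + 1 : ℕ) : ℝ)) m, e3,
      poch_succ_left' (2 * e) m]
    rw [poch_succ_left', e1] at h1
    have h10 := left_ne_zero_of_mul h1
    have h11 := right_ne_zero_of_mul h1
    rw [Nat.factorial_succ, poch_succ' B (m + 1), poch_succ' C (m + 1)]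
    simp only [poch_succ' (-(n : ℝ)) m, poch_succ' (2 * e + 1) m, poch_succ' D m, poch_succ' E m,
      poch_succ' (2 * e + 2 + n) m] at h3 h4 h11 ⊢
    have h30 := left_ne_zero_of_mul h3
    have h31 := right_ne_zero_of_mul h3
    have h40 := left_ne_zero_of_mul h4
    have h41 := right_ne_zero_of_mul h4
    have h50 := left_ne_zero_of_mul h11
    have h51 := right_ne_zero_of_mul h11
    have hf : (m.factorial : ℝ) ≠ 0 := by positivity
    have hm1 : (m : ℝ) + 1 ≠ 0 := by positivity
    push_cast
    generalize poch (-(n : ℝ)) m = p1 at *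
    generalize poch (2 * e + 1) m = p2 at *
    generalize poch B (m + 1) = p3 at *
    generalize poch C (m + 1) = p4 at *
    generalize poch (2 * e + 2 + n) m = p5 at *
    generalize poch D m = p6 at *
    generalize poch E m = p7 at *
    generalize poch e (m + 1) = p8 at *
    generalize (m.factorial : ℝ) = p9 at *
    generalize hw : 2 * e + 2 + (n : ℝ) + m = w at *
    generalize hv : 2 * e + 1 + (n : ℝ) = v at *
    generalize hx : D + (m : ℝ) = x at *
    generalize hy : E + (m : ℝ) = y at *
    field_simp
    subst hw hv hx hy hD hE
    ring

theorem vterm_sum (e B C D E : ℝ) (hD : D = 1 + 2 * e - B) (hE : E = 1 + 2 * e - C)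
    (n : ℕ) (he : poch e n ≠ 0) (h1 : poch (2 * e + 1) (2 * n) ≠ 0)
    (h3 : poch D n ≠ 0) (h4 : poch E n ≠ 0) :
    ∑ s ∈ Finset.range (n + 1), vterm n e B C D E s =
      poch (2 * e + 1) n * poch (D - C) n / (poch D n * poch E n) := by
  induction n with
  | zero => simp [vterm, poch_zero']
  | succ n ih =>
    have ih' := ih (poch_ne_le he (by omega)) (poch_ne_le h1 (by omega))
      (poch_ne_le h3 (by omega)) (poch_ne_le h4 (by omega))
    have h2 : poch (2 * e + 1 + n) (n + 1 + 1) ≠ 0 := by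
      rw [show 2 * (n + 1) = n + (n + 1 + 1) by ring, poch_add'] at h1
      exact right_ne_zero_of_mul h1
    have ht := vterm_tele n e B C D E hD hE (n + 1) he h2 h3 h4
    rw [poch_neg_self, Finset.sum_sub_distrib, ← Finset.mul_sum, ← Finset.mul_sum,
      Finset.sum_range_succ (fun s => vterm n e B C D E s) (n + 1), ih'] at ht
    have hz : vterm n e B C D E (n + 1) = 0 := by
      unfold vterm; rw [poch_neg_self]; simp
    rw [hz] at ht
    rw [poch_succ'] at h3 h4
    have h30 := left_ne_zero_of_mul h3
    have h31 := right_ne_zero_of_mul h3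
    have h40 := left_ne_zero_of_mul h4
    have h41 := right_ne_zero_of_mul h4
    simp only [poch_succ' D n, poch_succ' E n, poch_succ' (D - C) n, poch_succ' (2 * e + 1) n]
    rw [eq_div_iff (mul_ne_zero h3 h4)]
    simp only [zero_mul, zero_div, add_zero] at ht
    have hq := div_mul_cancel₀ (poch (2 * e + 1) n * poch (D - C) n) (mul_ne_zero h30 h40)
    linear_combination (poch D n * poch E n) * ht + (1 + 2 * e + n) * (D - C + n) * hq

theorem paraRacahEven_weight_sums (j : ℕ) (hj : 1 ≤ j) (a c α : ℝ)
    (hα₀ : 0 < α) (hα₁ : α < 1)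
    (hcase :
      (-(j : ℝ) < a + c ∧ a + c < -(j : ℝ) + 1 ∧ (a - c < -(j : ℝ) ∨ c - a < -(j : ℝ) + 1)) ∨
      ((a + c < -(2 * (j : ℝ)) + 1 ∨ 0 < a + c) ∧ 0 < c - a ∧ c - a < 1))
    (hp₁ : poch (a + c) (j + 1) ≠ 0) (hp₂ : poch (c - a) j ≠ 0)
    (hp₃ : poch (a - c) (j + 1) ≠ 0) (hp₄ : poch (2 * a + 1) j ≠ 0)
    (hp₅ : poch (2 * c + 1) (j - 1) ≠ 0) (hp₆ : poch a j ≠ 0)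
    (hp₇ : poch (2 * a + 1 + j) j ≠ 0) (hp₈ : poch (a - c + 1) j ≠ 0)
    (hp₉ : poch (a + c + j) j ≠ 0) (hp₁₀ : poch c (j - 1) ≠ 0)
    (hp₁₁ : poch (2 * c + j) (j - 1) ≠ 0) (hp₁₂ : poch (c - a + 1) (j - 1) ≠ 0)
    (hp₁₃ : poch (a + c + j + 1) (j - 1) ≠ 0) :
    (∑ s ∈ Finset.range (j + 1), wEven j a c α (2 * s)) = 1 - α ∧
    (∑ s ∈ Finset.range j, wEven j a c α (2 * s + 1)) = α := by
  have hf : ∀ k : ℕ, (k.factorial : ℝ) ≠ 0 := fun k => by positivity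
  constructor
  · have hD : a + c + j = 1 + 2 * a - (a - c - j + 1) := by ring
    have hE : a - c + 1 = 1 + 2 * a - (a + c) := by ring
    have h22 : poch (2 * a + 1) (2 * j) ≠ 0 := by
      rw [two_mul j, poch_add']; exact mul_ne_zero hp₄ hp₇
    have hs := vterm_sum a (a - c - j + 1) (a + c) (a + c + j) (a - c + 1) hD hE j hp₆ h22 hp₉ hp₈
    have hw : ∀ s, wEven j a c α (2 * s) = 2 * (1 - α) * kappaEven j a c /
        ((Nat.factorial j) * poch (a + c) j * poch (c - a) j * poch (2 * a + 1) j) *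
        vterm j a (a - c - j + 1) (a + c) (a + c + j) (a - c + 1) s := by
      intro s
      have h1 : 2 * s % 2 = 0 := by omega
      have h2 : 2 * s / 2 = s := by omega
      rw [wEven, if_pos h1, h2, vterm, div_mul_div_comm]
      congr 1 <;> ring
    simp only [hw]
    rw [← Finset.mul_sum, hs]
    have k1 : poch (a + c) (2 * j) = poch (a + c) j * poch (a + c + j) j := by
      rw [two_mul, poch_add']
    have k2 : poch (a - c - j + 1) (2 * j) = (-1) ^ j * poch (c - a) j * poch (a - c + 1) j := by
      rw [two_mul, poch_add', ← poch_reflect]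
      congr 2 <;> ring
    have k3 : (a + c + j - (a + c) : ℝ) = ((j - 1 : ℕ) : ℝ) + 1 := by
      push_cast [Nat.cast_sub hj]; ring
    have k4 := poch_fact (j - 1) j
    have k5 : ((2 * j).choose j : ℝ) * j.factorial * j.factorial = (2 * j).factorial := by
      have := Nat.choose_mul_factorial_mul_factorial (show j ≤ 2 * j by omega)
      rw [show 2 * j - j = j by omega] at this
      exact_mod_cast this
    rw [k3, kappaEven, k1, k2]
    have hac : poch (a + c) j ≠ 0 := poch_ne_le hp₁ (by omega)
    have hch : ((2 * j).choose j : ℝ) ≠ 0 := by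
      have := Nat.choose_pos (show j ≤ 2 * j by omega)
      positivity
    have key : 2 * poch (((j - 1 : ℕ) : ℝ) + 1) j = ((2 * j).choose j : ℝ) * j.factorial := by
      obtain ⟨i, rfl⟩ : ∃ i, j = i + 1 := ⟨j - 1, by omega⟩
      apply mul_right_cancel₀ (hf (i + 1))
      rw [k5, show 2 * (i + 1) = (i + (i + 1)) + 1 by ring, Nat.factorial_succ i,
        Nat.factorial_succ (i + (i + 1))]
      simp only [Nat.add_sub_cancel] at k4 ⊢
      push_cast at k4 ⊢
      rw [← k4]; ring
    have hj1 := hf j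
    have hneg : ((-1 : ℝ)) ^ j ≠ 0 := by simp
    generalize poch (((j - 1 : ℕ) : ℝ) + 1) j = q at *
    field_simp
    linear_combination (1 - α) * key
  · obtain ⟨i, rfl⟩ : ∃ i, j = i + 1 := ⟨j - 1, by omega⟩
    simp only [Nat.add_sub_cancel] at *
    have hD : a + c + ((i + 1 : ℕ) : ℝ) + 1 = 1 + 2 * c - (c - a - ((i + 1 : ℕ) : ℝ)) := by ring
    have hE : c - a + 1 = 1 + 2 * c - (a + c) := by ring
    have hci : 2 * c + ((i + 1 : ℕ) : ℝ) = 2 * c + 1 + i := by push_cast; ring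
    have h22 : poch (2 * c + 1) (2 * i) ≠ 0 := by
      rw [two_mul i, poch_add']
      exact mul_ne_zero hp₅ (hci ▸ hp₁₁)
    have hs := vterm_sum c (c - a - ((i + 1 : ℕ) : ℝ)) (a + c) (a + c + ((i + 1 : ℕ) : ℝ) + 1)
      (c - a + 1) hD hE i hp₁₀ h22 hp₁₃ hp₁₂
    have hni : -((i + 1 : ℕ) : ℝ) + 1 = -(i : ℝ) := by push_cast; ring
    have hw : ∀ s, wEven (i + 1) a c α (2 * s + 1) = -2 * α * kappaEven (i + 1) a c /
        ((Nat.factorial i) * poch (a + c) (i + 1 + 1) * poch (a - c) (i + 1 + 1)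
          * poch (2 * c + 1) i) *
        vterm i c (c - a - ((i + 1 : ℕ) : ℝ)) (a + c) (a + c + ((i + 1 : ℕ) : ℝ) + 1)
          (c - a + 1) s := by
      intro s
      have h1 : ¬ (2 * s + 1) % 2 = 0 := by omega
      have h2 : (2 * s + 1) / 2 = s := by omega
      rw [wEven, if_neg h1, h2, vterm, div_mul_div_comm, hni, hci, Nat.add_sub_cancel]
      congr 1 <;> ring
    simp only [hw]
    rw [← Finset.mul_sum, hs]
    have k1 : poch (a + c) (2 * (i + 1)) =
        poch (a + c) (i + 1 + 1) * poch (a + c + ((i + 1 : ℕ) : ℝ) + 1) i := by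
      rw [show 2 * (i + 1) = (i + 1 + 1) + i by ring, poch_add']
      congr 2; push_cast; ring
    have k2 : poch (a - c - ((i + 1 : ℕ) : ℝ) + 1) (2 * (i + 1)) =
        (-1) ^ i * poch (c - a + 1) i * poch (a - c) (i + 1 + 1) := by
      rw [show 2 * (i + 1) = i + (i + 1 + 1) by ring, poch_add', ← poch_reflect]
      congr 2 <;> (push_cast; ring)
    have k3 : (a + c + ((i + 1 : ℕ) : ℝ) + 1 - (a + c) : ℝ) = ((i + 1 : ℕ) : ℝ) + 1 := by
      ring
    have k4 := poch_fact (i + 1) i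
    have k5 : ((2 * (i + 1)).choose (i + 1) : ℝ) * (i + 1).factorial * (i + 1).factorial
        = (2 * (i + 1)).factorial := by
      have := Nat.choose_mul_factorial_mul_factorial (show i + 1 ≤ 2 * (i + 1) by omega)
      rw [show 2 * (i + 1) - (i + 1) = i + 1 by omega] at this
      exact_mod_cast this
    rw [k3, kappaEven, k1, k2]
    have hch : ((2 * (i + 1)).choose (i + 1) : ℝ) ≠ 0 := by
      have := Nat.choose_pos (show i + 1 ≤ 2 * (i + 1) by omega)
      positivity
    have key : 2 * poch (((i + 1 : ℕ) : ℝ) + 1) i =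
        ((2 * (i + 1)).choose (i + 1) : ℝ) * i.factorial := by
      apply mul_right_cancel₀ (hf (i + 1))
      have hi : (i : ℝ) + 1 ≠ 0 := by positivity
      apply mul_left_cancel₀ hi
      have k6 : ((i + 1).factorial : ℝ) = ((i : ℝ) + 1) * i.factorial := by
        rw [Nat.factorial_succ]; push_cast; ring
      have k7 : ((2 * (i + 1)).factorial : ℝ) = (2 * i + 2) * (i + 1 + i).factorial := by
        rw [show 2 * (i + 1) = (i + 1 + i) + 1 by ring, Nat.factorial_succ]; push_cast; ring
      rw [k7, ← k4] at k5
      rw [show ((i : ℝ) + 1) * (((2 * (i + 1)).choose (i + 1) : ℝ) * i.factorial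
        * (i + 1).factorial) = ((2 * (i + 1)).choose (i + 1) : ℝ) * (((i : ℝ) + 1) * i.factorial)
        * (i + 1).factorial by ring, ← k6, k5]
      ring
    have hi1 := hf i
    have hneg : ((-1 : ℝ)) ^ i ≠ 0 := by simp
    rw [pow_succ]
    generalize poch (((i + 1 : ℕ) : ℝ) + 1) i = q at *
    generalize poch (a + c + ((i + 1 : ℕ) : ℝ) + 1) i = q2 at *
    field_simp
    linear_combination key
end
end
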